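/- arXiv:0802.1185 — 2 statements merged into one kernel-verified Lean document; each statement's English description precedes it below -/
import Mathlib

section
/- Let Ω ⊂ ℝ^n be a bounded domain with boundary of class C^{1+ε}, 0 < ε < 1, let T be an even smooth homogeneous Calderón–Zygmund operator with kernel K, let 0 < α < 1, 0 < β ≤ ε with β < α, and let a : Ω → ℂ have finite Hölder seminorm σ_α(a). Then the commutator [T,a], defined by [T,a](f)(x) = ∫_Ω (a(x) − a(y)) K(x−y) f(y) dy, is compact as an operator from Lip(β,Ω) into itself: for every sequence (f_k) with ‖f_k‖_{β,Ω} ≤ 1 there is a subsequence (f_{k_j}) such that [T,a](f_{k_j}) converges in the norm ‖·‖_{β,Ω}. -/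
open MeasureTheory Metric Set Filter Topology
open scoped ENNReal NNReal

noncomputable section

/-- `ℝ^n` with the Euclidean norm. -/
abbrev En (n : ℕ) : Type := EuclideanSpace ℝ (Fin n)

/-- The Hölder norm `‖f‖_{ε,Ω} = sup_Ω |f| + σ_ε(f)`, valued in `ℝ≥0∞`. -/
def holderNorm {X : Type*} [NormedAddCommGroup X] (ε : ℝ) (Ω : Set X) (f : X → ℂ) : ℝ≥0∞ :=
  (⨆ x : Ω, (‖f x.1‖₊ : ℝ≥0∞)) +
    ⨆ p : Ω × Ω, ENNReal.ofReal (‖f p.1.1 - f p.2.1‖ / ‖p.1.1 - p.2.1‖ ^ ε)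

/-- The Calderón–Zygmund constant `‖T‖_CZ = sup_{x≠0}|K(x)||x|^n + sup_{x≠0}|∇K(x)||x|^{n+1}`. -/
def czConst (n : ℕ) (K : En n → ℝ) : ℝ≥0∞ :=
  (⨆ x : {x : En n // x ≠ 0}, ENNReal.ofReal (|K x.1| * ‖x.1‖ ^ n)) +
    ⨆ x : {x : En n // x ≠ 0}, ENNReal.ofReal (‖fderiv ℝ K x.1‖ * ‖x.1‖ ^ (n + 1))

/-- `Ω ⊆ ℝ^n` has boundary of class `C^{1+ε}`: near each boundary point, after a rotation,
`Ω` is the subgraph of a `C^1` function whose gradient is `ε`-Hölder. -/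
def HasC1HolderBoundary (n : ℕ) (ε : ℝ) (Ω : Set (En n)) : Prop :=
  ∃ hn : 0 < n, ∀ a ∈ frontier Ω, ∃ r > 0,
    ∃ R : En n ≃ₗᵢ[ℝ] En n, ∃ φ : (Fin (n - 1) → ℝ) → ℝ,
      ContDiff ℝ 1 φ ∧
      (∃ c : ℝ≥0, HolderOnWith c ε.toNNReal (fderiv ℝ φ) univ) ∧
      Ω ∩ ball a r = {x ∈ ball a r |
        R x ⟨n - 1, Nat.sub_lt hn Nat.one_pos⟩ <
          φ fun i : Fin (n - 1) => R x (Fin.castLE (Nat.sub_le n 1) i)}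


/-- Hölder seminorm `σ_α(f)` on `Ω`, valued in `ℝ≥0∞`. -/
def holderSemi {X : Type*} [NormedAddCommGroup X] (α : ℝ) (Ω : Set X) (f : X → ℂ) : ℝ≥0∞ :=
  ⨆ p : Ω × Ω, ENNReal.ofReal (‖f p.1.1 - f p.2.1‖ / ‖p.1.1 - p.2.1‖ ^ α)


lemma aux_kernel (n : ℕ) (ω K : En n → ℝ)
    (hK : ∀ x, x ≠ 0 → K x = ω x / ‖x‖ ^ n)
    (hω : ∀ t : ℝ, 0 < t → ∀ x, ω (t • x) = ω x)
    (hC : ContDiffOn ℝ 1 ω {(0 : En n)}ᶜ) :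
    ContinuousOn K {(0 : En n)}ᶜ ∧ ∃ C : ℝ, 0 ≤ C ∧
      (∀ x, x ≠ 0 → |K x| ≤ C * ‖x‖ ^ (-(n : ℝ))) ∧
      (∀ u v, u ≠ 0 → ‖u - v‖ ≤ ‖u‖ / 2 →
        |K u - K v| ≤ C * ‖u - v‖ * ‖u‖ ^ (-(n : ℝ) - 1)) := by
  have hKC : ContDiffOn ℝ 1 K {(0 : En n)}ᶜ := by
    have h1 : ContDiffOn ℝ 1 (fun x : En n => ω x / ‖x‖ ^ n) {(0 : En n)}ᶜ := by
      apply ContDiffOn.div hC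
      · apply ContDiffOn.pow
        intro x hx
        exact (contDiffAt_norm ℝ hx).contDiffWithinAt
      · intro x hx
        have : x ≠ 0 := hx
        positivity
    exact h1.congr fun x hx => hK x hx
  have hop : IsOpen ({(0 : En n)}ᶜ : Set (En n)) := isOpen_compl_singleton
  have hKc := hKC.continuousOn
  refine ⟨hKc, ?_⟩
  let S : Set (En n) := closedBall 0 2 \ ball 0 (1/2)
  have hS : IsCompact S := (isCompact_closedBall 0 2).diff isOpen_ball
  have hS0 : S ⊆ {(0 : En n)}ᶜ := by
    intro x hx h0
    have : x = 0 := h0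
    subst this
    exact hx.2 (by simp)
  obtain ⟨C1, hC1⟩ := hS.exists_bound_of_continuousOn (hKc.mono hS0)
  obtain ⟨C2, hC2⟩ := hS.exists_bound_of_continuousOn
    ((hKC.continuousOn_fderiv_of_isOpen hop le_rfl).mono hS0)
  have hscale : ∀ t : ℝ, 0 < t → ∀ x, x ≠ 0 → K (t • x) = t ^ (-(n : ℝ)) * K x := by
    intro t ht x hx
    rw [hK _ (smul_ne_zero ht.ne' hx), hK x hx, hω t ht, norm_smul, Real.norm_of_nonneg ht.le,
      Real.rpow_neg ht.le, Real.rpow_natCast, mul_pow]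
    have : ‖x‖ ≠ 0 := by simpa using hx
    field_simp
  have hnorm : ∀ u : En n, u ≠ 0 → ‖(‖u‖⁻¹ • u)‖ = 1 := by
    intro u hu
    rw [norm_smul, norm_inv, norm_norm, inv_mul_cancel₀ (by simpa using hu)]
  refine ⟨max (max C1 C2) 0, le_max_right _ _, ?_, ?_⟩
  · intro x hx
    have hx' : 0 < ‖x‖ := by simpa using hx
    have e : x = ‖x‖ • (‖x‖⁻¹ • x) := by rw [smul_smul, mul_inv_cancel₀ hx'.ne', one_smul]
    have hne : ‖x‖⁻¹ • x ≠ 0 := smul_ne_zero (inv_ne_zero hx'.ne') hx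
    have h := hscale ‖x‖ hx' _ hne
    rw [← e] at h
    rw [h, abs_mul, abs_of_nonneg (by positivity), mul_comm]
    gcongr
    have := hC1 (‖x‖⁻¹ • x) ⟨by simp only [mem_closedBall_zero_iff, hnorm x hx]; norm_num,
      by simp only [mem_ball_zero_iff, hnorm x hx]; norm_num⟩
    rw [Real.norm_eq_abs] at this
    exact this.trans ((le_max_left _ _).trans (le_max_left _ _))
  · intro u v hu huv
    have hu' : 0 < ‖u‖ := by simpa using hu
    set e := ‖u‖⁻¹ • u with he
    set e' := ‖u‖⁻¹ • v with he'
    have h1 : ‖e‖ = 1 := hnorm u hu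
    have h2 : ‖e - e'‖ = ‖u‖⁻¹ * ‖u - v‖ := by
      rw [he, he', ← smul_sub, norm_smul, norm_inv, norm_norm]
    have h3 : ‖e - e'‖ ≤ 1/2 := by
      rw [h2, inv_mul_le_iff₀ hu']; linarith
    have hB : closedBall e (1/2) ⊆ S := by
      intro z hz
      rw [mem_closedBall, dist_eq_norm] at hz
      have a1 := norm_sub_norm_le z e
      have a2 := norm_sub_norm_le e z
      rw [norm_sub_rev] at a2
      refine ⟨?_, ?_⟩
      · rw [mem_closedBall_zero_iff]; linarith
      · rw [mem_ball_zero_iff]; linarith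
    have he'B : e' ∈ closedBall e (1/2) := by
      rw [mem_closedBall, dist_eq_norm, norm_sub_rev]; exact h3
    have heB : e ∈ closedBall e (1/2) := by simp
    have hmv := (convex_closedBall e (1/2)).norm_image_sub_le_of_norm_fderiv_le (𝕜 := ℝ) (f := K)
      (C := C2)
      (fun x hx => (hKC.differentiableOn (by simp)).differentiableAt (hop.mem_nhds (hS0 (hB hx))))
      (fun x hx => hC2 x (hB hx)) he'B heB
    have eu : u = ‖u‖ • e := by rw [he, smul_smul, mul_inv_cancel₀ hu'.ne', one_smul]
    have ev : v = ‖u‖ • e' := by rw [he', smul_smul, mul_inv_cancel₀ hu'.ne', one_smul]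
    have ku : K u = ‖u‖ ^ (-(n:ℝ)) * K e := by
      conv_lhs => rw [eu]
      exact hscale _ hu' _ (hS0 (hB heB))
    have kv : K v = ‖u‖ ^ (-(n:ℝ)) * K e' := by
      conv_lhs => rw [ev]
      exact hscale _ hu' _ (hS0 (hB he'B))
    rw [ku, kv, ← mul_sub, abs_mul, abs_of_nonneg (by positivity), Real.rpow_sub hu', Real.rpow_one]
    rw [Real.norm_eq_abs, h2] at hmv
    calc ‖u‖ ^ (-(n:ℝ)) * |K e - K e'| ≤ ‖u‖ ^ (-(n:ℝ)) * (C2 * (‖u‖⁻¹ * ‖u - v‖)) := by gcongr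
      _ ≤ ‖u‖ ^ (-(n:ℝ)) * ((max (max C1 C2) 0) * (‖u‖⁻¹ * ‖u - v‖)) := by
        gcongr
        exact (le_max_right _ _).trans (le_max_left _ _)
      _ = _ := by field_simp

lemma aux_potential (n : ℕ) (hn : 0 < n) (p : ℝ) (hp : 0 < p) (Ω : Set (En n))
    (hΩb : Bornology.IsBounded Ω) :
    ∃ I : ℝ, 0 ≤ I ∧ ∀ x ∈ Ω, IntegrableOn (fun y => ‖x - y‖ ^ (p - n)) Ω ∧
      ∫ y in Ω, ‖x - y‖ ^ (p - n) ≤ I := by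
  obtain ⟨D, hD0, hD⟩ : ∃ D : ℝ, 0 < D ∧ ∀ x ∈ Ω, ∀ y ∈ Ω, ‖x - y‖ < D := by
    obtain ⟨D, hD⟩ := Metric.isBounded_iff.1 hΩb
    refine ⟨max D 0 + 1, by positivity, fun x hx y hy => ?_⟩
    rw [← dist_eq_norm]
    have := hD hx hy
    have := le_max_left D 0
    linarith
  have : Nonempty (Fin n) := ⟨⟨0, hn⟩⟩
  have : Nontrivial (En n) := inferInstance
  have hball : IntegrableOn (fun z : En n => ‖z‖ ^ (p - n)) (ball 0 D) := by
    rw [integrableOn_fun_norm_addHaar (volume : Measure (En n)) (f := fun t : ℝ => t ^ (p - n))]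
    have h1 : IntegrableOn (fun y : ℝ => y ^ (p - 1)) (Ioo 0 D) := by
      rw [intervalIntegral.integrableOn_Ioo_rpow_iff hD0]; linarith
    refine h1.congr_fun ?_ measurableSet_Ioo
    intro y hy
    have hy0 : 0 < y := hy.1
    simp only [finrank_euclideanSpace, Fintype.card_fin, smul_eq_mul]
    rw [← Real.rpow_natCast, ← Real.rpow_add hy0, Nat.cast_sub hn]
    congr 1
    push_cast; ring
  have hmp : ∀ x : En n, MeasurePreserving (fun y => x - y) (volume : Measure (En n)) volume :=
    fun x => Measure.measurePreserving_sub_left volume x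
  have hme : ∀ x : En n, MeasurableEmbedding (fun y : En n => x - y) :=
    fun x => (Homeomorph.subLeft x).measurableEmbedding
  have hsub : ∀ x ∈ Ω, Ω ⊆ (fun y => x - y) ⁻¹' (ball (0 : En n) D) := by
    intro x hx y hy
    simpa using hD x hx y hy
  have hint : ∀ x : En n, IntegrableOn (fun y => ‖x - y‖ ^ (p - n))
      ((fun y => x - y) ⁻¹' (ball (0 : En n) D)) := fun x =>
    ((hmp x).integrableOn_comp_preimage (hme x) (f := fun z => ‖z‖ ^ (p - n))).2 hball
  refine ⟨∫ z in ball (0 : En n) D, ‖z‖ ^ (p - n), by positivity, fun x hx => ⟨(hint x).mono_set (hsub x hx), ?_⟩⟩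
  rw [← (hmp x).setIntegral_preimage_emb (hme x) (fun z => ‖z‖ ^ (p - n))]
  apply setIntegral_mono_set (hint x)
  · exact Eventually.of_forall fun y => by positivity
  · exact (hsub x hx).eventuallyLE

lemma aux_pow (γ p r d q : ℝ) (hγ0 : 0 < γ) (hγ1 : γ ≤ 1) (hd : 0 ≤ d) (hr : 0 ≤ r)
    (hrd : r ≤ 3 * d) (hq : γ + p - q ≠ 0) :
    r ^ (γ + p - q) ≤ 3 * d ^ γ * r ^ (p - q) := by
  rcases hr.eq_or_lt with h | h
  · subst h
    rw [Real.zero_rpow hq]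
    positivity
  · have e : γ + p - q = γ + (p - q) := by ring
    rw [e, Real.rpow_add h]
    gcongr
    calc r ^ γ ≤ (3 * d) ^ γ := by gcongr
      _ = 3 ^ γ * d ^ γ := Real.mul_rpow (by norm_num) hd
      _ ≤ 3 ^ (1 : ℝ) * d ^ γ := by
        gcongr
        norm_num
      _ = 3 * d ^ γ := by rw [Real.rpow_one]

lemma aux_point (n : ℕ) (hn : 0 < n) (α γ A C : ℝ) (hγ0 : 0 < γ) (hγα : γ < α) (hα1 : α < 1)
    (hA : 0 ≤ A) (hC : 0 ≤ C) (Ω : Set (En n)) (a : En n → ℂ) (K : En n → ℝ)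
    (ha : ∀ x ∈ Ω, ∀ y ∈ Ω, ‖a x - a y‖ ≤ A * ‖x - y‖ ^ α)
    (hK1 : ∀ x, x ≠ 0 → |K x| ≤ C * ‖x‖ ^ (-(n : ℝ)))
    (hK2 : ∀ u v, u ≠ 0 → ‖u - v‖ ≤ ‖u‖ / 2 →
        |K u - K v| ≤ C * ‖u - v‖ * ‖u‖ ^ (-(n : ℝ) - 1)) :
    (∀ x ∈ Ω, ∀ y ∈ Ω, ‖(a x - a y) * (K (x - y) : ℂ)‖ ≤ A * C * ‖x - y‖ ^ (α - n)) ∧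
    (∀ x ∈ Ω, ∀ x' ∈ Ω, ∀ y ∈ Ω,
      ‖(a x - a y) * (K (x - y) : ℂ) - (a x' - a y) * (K (x' - y) : ℂ)‖ ≤
        3 * (A * C) * ‖x - x'‖ ^ γ * (‖x - y‖ ^ (α - γ - n) + ‖x' - y‖ ^ (α - γ - n))) := by
  have hn1 : (1 : ℝ) ≤ n := by exact_mod_cast hn
  have P1 : ∀ x ∈ Ω, ∀ y ∈ Ω,
      ‖(a x - a y) * (K (x - y) : ℂ)‖ ≤ A * C * ‖x - y‖ ^ (α - n) := by
    intro x hx y hy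
    by_cases h : x = y
    · subst h
      simp only [sub_self, zero_mul, norm_zero]
      positivity
    · have h0 : x - y ≠ 0 := sub_ne_zero.2 h
      have hp : 0 < ‖x - y‖ := by simpa using h0
      rw [norm_mul, Complex.norm_real, Real.norm_eq_abs, sub_eq_add_neg α, Real.rpow_add hp]
      calc _ ≤ (A * ‖x - y‖ ^ α) * (C * ‖x - y‖ ^ (-(n : ℝ))) := by
            gcongr
            · exact ha x hx y hy
            · exact hK1 _ h0
        _ = _ := by ring
  refine ⟨P1, ?_⟩
  intro x hx x' hx' y hy
  set d := ‖x - x'‖ with hd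
  have hd0 : 0 ≤ d := norm_nonneg _
  have hAC : 0 ≤ A * C := mul_nonneg hA hC
  have htri : ‖x' - y‖ ≤ d + ‖x - y‖ := by
    have : x' - y = -(x - x') + (x - y) := by abel
    rw [this, hd, ← norm_neg (x - x')]
    exact norm_add_le _ _
  by_cases hr : ‖x - y‖ ≤ 2 * d
  · have e : γ + (α - γ) - (n : ℝ) = α - n := by ring
    have hne : γ + (α - γ) - (n : ℝ) ≠ 0 := by rw [e]; linarith
    have q1 := aux_pow γ (α - γ) ‖x - y‖ d n hγ0 (by linarith) hd0 (norm_nonneg _)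
      (by linarith) hne
    have q2 := aux_pow γ (α - γ) ‖x' - y‖ d n hγ0 (by linarith) hd0 (norm_nonneg _)
      (by linarith) hne
    rw [e] at q1 q2
    calc _ ≤ ‖(a x - a y) * (K (x - y) : ℂ)‖ + ‖(a x' - a y) * (K (x' - y) : ℂ)‖ :=
          norm_sub_le _ _
      _ ≤ A * C * ‖x - y‖ ^ (α - n) + A * C * ‖x' - y‖ ^ (α - n) :=
          add_le_add (P1 x hx y hy) (P1 x' hx' y hy)
      _ ≤ A * C * (3 * d ^ γ * ‖x - y‖ ^ (α - γ - n))
          + A * C * (3 * d ^ γ * ‖x' - y‖ ^ (α - γ - n)) := by gcongr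
      _ = _ := by ring
  · push Not at hr
    set r := ‖x - y‖ with hrdef
    have hr0 : 0 < r := by linarith
    have hxy : x - y ≠ 0 := by
      intro h
      rw [h, norm_zero] at hrdef
      linarith
    have hdd : (x - y) - (x' - y) = x - x' := by abel
    have e : (a x - a y) * (K (x - y) : ℂ) - (a x' - a y) * (K (x' - y) : ℂ)
        = (a x - a x') * (K (x - y) : ℂ) + (a x' - a y) * ((K (x - y) - K (x' - y) : ℝ) : ℂ) := by
      push_cast; ring
    have t1 : ‖(a x - a x') * (K (x - y) : ℂ)‖ ≤ A * C * (d ^ γ * r ^ (α - γ - n)) := by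
      rw [norm_mul, Complex.norm_real, Real.norm_eq_abs]
      have e1 : d ^ α = d ^ γ * d ^ (α - γ) := by
        rw [← Real.rpow_add_of_nonneg hd0 hγ0.le (by linarith)]; congr 1; ring
      have e2 : r ^ (α - γ - n) = r ^ (α - γ) * r ^ (-(n : ℝ)) := by
        rw [← Real.rpow_add hr0]; congr 1
      calc _ ≤ (A * d ^ α) * (C * r ^ (-(n : ℝ))) := by
            gcongr
            · exact ha x hx x' hx'
            · exact hK1 _ hxy
        _ = A * C * (d ^ γ * (d ^ (α - γ) * r ^ (-(n : ℝ)))) := by rw [e1]; ring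
        _ ≤ A * C * (d ^ γ * (r ^ (α - γ) * r ^ (-(n : ℝ)))) := by
            have : d ^ (α - γ) ≤ r ^ (α - γ) :=
              Real.rpow_le_rpow hd0 (by linarith) (by linarith)
            gcongr
        _ = _ := by rw [e2]
    have t2 : ‖(a x' - a y) * ((K (x - y) - K (x' - y) : ℝ) : ℂ)‖
        ≤ 2 * (A * C) * (d ^ γ * r ^ (α - γ - n)) := by
      rw [norm_mul, Complex.norm_real, Real.norm_eq_abs]
      have hk := hK2 (x - y) (x' - y) hxy (by rw [hdd, ← hd, ← hrdef]; linarith)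
      rw [hdd, ← hd, ← hrdef] at hk
      have b1 : ‖x' - y‖ ^ α ≤ 2 * r ^ α := by
        calc ‖x' - y‖ ^ α ≤ (2 * r) ^ α :=
              Real.rpow_le_rpow (norm_nonneg _) (by linarith) (by linarith)
          _ = 2 ^ α * r ^ α := Real.mul_rpow (by norm_num) hr0.le
          _ ≤ 2 ^ (1 : ℝ) * r ^ α := by
            gcongr
            norm_num
          _ = _ := by rw [Real.rpow_one]
      have b2 : d ≤ d ^ γ * r ^ (1 - γ) := by
        calc d = d ^ γ * d ^ (1 - γ) := by
              rw [← Real.rpow_add_of_nonneg hd0 hγ0.le (by linarith)]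
              simp
          _ ≤ _ := by
            have : d ^ (1 - γ) ≤ r ^ (1 - γ) :=
              Real.rpow_le_rpow hd0 (by linarith) (by linarith)
            gcongr
      have b3 : r ^ (α - γ - n) = r ^ α * r ^ (1 - γ) * r ^ (-(n : ℝ) - 1) := by
        rw [← Real.rpow_add hr0, ← Real.rpow_add hr0]; congr 1; ring
      calc _ ≤ (A * ‖x' - y‖ ^ α) * (C * d * r ^ (-(n : ℝ) - 1)) := by
            gcongr
            exact ha x' hx' y hy
        _ ≤ (A * (2 * r ^ α)) * (C * (d ^ γ * r ^ (1 - γ)) * r ^ (-(n : ℝ) - 1)) := by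
            gcongr
        _ = _ := by rw [b3]; ring
    rw [e]
    have hnn : 0 ≤ ‖x' - y‖ ^ (α - γ - n) := by positivity
    calc _ ≤ A * C * (d ^ γ * r ^ (α - γ - n)) + 2 * (A * C) * (d ^ γ * r ^ (α - γ - n)) :=
          (norm_add_le _ _).trans (add_le_add t1 t2)
      _ = 3 * (A * C) * d ^ γ * (r ^ (α - γ - n) + 0) := by ring
      _ ≤ _ := by gcongr

lemma aux_compact (n : ℕ) (β γ M : ℝ) (hβ0 : 0 < β) (hβγ : β < γ) (hM : 0 ≤ M)
    (Ω : Set (En n)) (hne : Ω.Nonempty) (hb : Bornology.IsBounded Ω) (F : ℕ → En n → ℂ)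
    (hF1 : ∀ k, ∀ x ∈ Ω, ‖F k x‖ ≤ M)
    (hF2 : ∀ k, ∀ x ∈ Ω, ∀ y ∈ Ω, ‖F k x - F k y‖ ≤ M * ‖x - y‖ ^ γ) :
    ∃ φ : ℕ → ℕ, StrictMono φ ∧ ∃ g : En n → ℂ,
      Tendsto (fun j => holderNorm β Ω (F (φ j) - g)) atTop (𝓝 0) := by
  have hγ0 : 0 < γ := hβ0.trans hβγ
  have hnΩ : Nonempty Ω := hne.to_subtype
  -- modulus of continuity
  have hmod : ∀ e > 0, ∃ δ > 0, ∀ r : ℝ, 0 ≤ r → r < δ → M * r ^ γ < e := by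
    intro e he
    have hc : ContinuousAt (fun r : ℝ => M * r ^ γ) 0 :=
      continuousAt_const.mul (Real.continuousAt_rpow_const 0 γ (Or.inr hγ0.le))
    obtain ⟨δ, hδ, h⟩ := Metric.continuousAt_iff.1 hc e he
    refine ⟨δ, hδ, fun r hr hrd => ?_⟩
    have := h (x := r) (by rw [dist_zero_right, Real.norm_of_nonneg hr]; exact hrd)
    rw [Real.zero_rpow hγ0.ne', mul_zero, dist_zero_right] at this
    exact (le_abs_self _).trans_lt this
  let q : ℕ → Ω := TopologicalSpace.denseSeq Ω
  have hcomp : IsCompact (Set.pi univ (fun _ : ℕ => closedBall (0 : ℂ) M)) :=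
    isCompact_univ_pi fun _ => isCompact_closedBall _ _
  obtain ⟨L, -, φ, hφ, hL⟩ := hcomp.tendsto_subseq (x := fun k m => F k (q m))
    (fun k m _ => by simpa using hF1 k _ (q m).2)
  rw [tendsto_pi_nhds] at hL
  have hcau : ∀ x ∈ Ω, CauchySeq (fun j => F (φ j) x) := by
    intro x hx
    rw [Metric.cauchySeq_iff]
    intro e he
    obtain ⟨δ, hδ, hδ'⟩ := hmod (e / 3) (by positivity)
    obtain ⟨m, hm⟩ := (TopologicalSpace.denseRange_denseSeq Ω).exists_dist_lt ⟨x, hx⟩ hδ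
    have hm' : ‖x - (q m : En n)‖ < δ := by rw [← dist_eq_norm]; exact hm
    obtain ⟨N, hN⟩ := Metric.cauchySeq_iff.1 (hL m).cauchySeq (e / 3) (by positivity)
    refine ⟨N, fun i hi j hj => ?_⟩
    have h1 := (hF2 (φ i) x hx _ (q m).2).trans_lt (hδ' _ (norm_nonneg _) hm')
    have h2 := (hF2 (φ j) x hx _ (q m).2).trans_lt (hδ' _ (norm_nonneg _) hm')
    have h3 : dist (F (φ i) (q m)) (F (φ j) (q m)) < e / 3 := hN i hi j hj
    rw [← dist_eq_norm] at h1 h2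
    rw [dist_comm] at h2
    have := dist_triangle4 (F (φ i) x) (F (φ i) (q m)) (F (φ j) (q m)) (F (φ j) x)
    linarith
  have hlim : ∀ x, ∃ l : ℂ, x ∈ Ω → Tendsto (fun j => F (φ j) x) atTop (𝓝 l) := by
    intro x
    by_cases hx : x ∈ Ω
    · obtain ⟨l, hl⟩ := cauchySeq_tendsto_of_complete (hcau x hx)
      exact ⟨l, fun _ => hl⟩
    · exact ⟨0, fun h => absurd h hx⟩
  choose g hg using hlim
  have hg2 : ∀ x ∈ Ω, ∀ y ∈ Ω, ‖g x - g y‖ ≤ M * ‖x - y‖ ^ γ := by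
    intro x hx y hy
    exact le_of_tendsto ((hg x hx).sub (hg y hy)).norm
      (Eventually.of_forall fun j => hF2 (φ j) x hx y hy)
  have hunif : ∀ e > 0, ∀ᶠ j in atTop, ∀ x ∈ Ω, ‖F (φ j) x - g x‖ ≤ e := by
    intro e he
    obtain ⟨δ, hδ, hδ'⟩ := hmod (e / 3) (by positivity)
    obtain ⟨t, htΩ, htf, htc⟩ :=
      Metric.finite_approx_of_totallyBounded (hb.isCompact_closure.totallyBounded.subset subset_closure) δ hδ
    have hev : ∀ᶠ j in atTop, ∀ z ∈ t, dist (F (φ j) z) (g z) < e / 3 := by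
      rw [Filter.eventually_all_finite htf]
      intro z hz
      exact (Metric.tendsto_nhds.1 (hg z (htΩ hz))) _ (by positivity)
    filter_upwards [hev] with j hj x hx
    obtain ⟨z, hz, hxz⟩ := mem_iUnion₂.1 (htc hx)
    have hxz' : ‖x - z‖ < δ := by rw [← dist_eq_norm]; exact hxz
    have h1 := (hF2 (φ j) x hx _ (htΩ hz)).trans_lt (hδ' _ (norm_nonneg _) hxz')
    have h2 := (hg2 x hx _ (htΩ hz)).trans_lt (hδ' _ (norm_nonneg _) hxz')
    have h3 := hj z hz
    rw [← dist_eq_norm] at h1 h2 ⊢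
    rw [dist_comm] at h2
    have := dist_triangle4 (F (φ j) x) (F (φ j) z) (g z) (g x)
    linarith
  refine ⟨φ, hφ, g, ?_⟩
  set θ := β / γ with hθ
  have hθ0 : 0 < θ := by positivity
  have hθ1 : θ < 1 := by rw [hθ, div_lt_one hγ0]; exact hβγ
  let G : ℝ → ℝ := fun η => η + (2 * M) ^ θ * (2 * η) ^ (1 - θ)
  have hG : Tendsto (fun η => ENNReal.ofReal (G η)) (𝓝[>] 0) (𝓝 0) := by
    have hc : ContinuousAt G 0 := by
      apply continuousAt_id.add
      apply continuousAt_const.mul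
      exact ContinuousAt.rpow_const (by fun_prop) (Or.inr (by linarith))
    have h0 : G 0 = 0 := by
      simp only [G, mul_zero, zero_add]
      rw [Real.zero_rpow (by linarith), mul_zero]
    have h1 : Tendsto G (𝓝[>] 0) (𝓝 0) := by
      have := hc.tendsto
      rw [h0] at this
      exact this.mono_left nhdsWithin_le_nhds
    simpa using ENNReal.tendsto_ofReal h1
  rw [ENNReal.tendsto_nhds_zero]
  intro e he
  obtain ⟨η, hη, hη0⟩ := ((ENNReal.tendsto_nhds_zero.1 hG e he).and self_mem_nhdsWithin).exists
  have hη0 : 0 < η := hη0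
  filter_upwards [hunif η hη0] with j hj
  refine le_trans ?_ hη
  rw [holderNorm, ENNReal.ofReal_add hη0.le (by positivity)]
  refine add_le_add ?_ ?_
  · refine iSup_le fun x => ?_
    rw [← enorm_eq_nnnorm, ← ofReal_norm]
    exact ENNReal.ofReal_le_ofReal (hj x.1 x.2)
  · refine iSup_le fun ⟨⟨x, hx⟩, ⟨y, hy⟩⟩ => ENNReal.ofReal_le_ofReal ?_
    simp only [Pi.sub_apply]
    set w := ‖F (φ j) x - g x - (F (φ j) y - g y)‖ with hw
    have w0 : 0 ≤ w := norm_nonneg _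
    have w1 : w ≤ 2 * η := by
      have := norm_sub_le (F (φ j) x - g x) (F (φ j) y - g y)
      have := hj x hx
      have := hj y hy
      linarith
    have w2 : w ≤ 2 * M * ‖x - y‖ ^ γ := by
      have e1 : F (φ j) x - g x - (F (φ j) y - g y) =
        (F (φ j) x - F (φ j) y) - (g x - g y) := by ring
      have := norm_sub_le (F (φ j) x - F (φ j) y) (g x - g y)
      have := hF2 (φ j) x hx y hy
      have := hg2 x hx y hy
      rw [hw, e1]
      linarith
    apply div_le_of_le_mul₀ (by positivity) (by positivity)
    calc w = w ^ θ * w ^ (1 - θ) := by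
          rw [← Real.rpow_add_of_nonneg w0 hθ0.le (by linarith)]; simp
      _ ≤ (2 * M * ‖x - y‖ ^ γ) ^ θ * (2 * η) ^ (1 - θ) := by
          have := Real.rpow_le_rpow w0 w2 hθ0.le
          have := Real.rpow_le_rpow w0 w1 (by linarith : 0 ≤ 1 - θ)
          gcongr
      _ = (2 * M) ^ θ * (2 * η) ^ (1 - θ) * ‖x - y‖ ^ β := by
          rw [Real.mul_rpow (by positivity) (by positivity), ← Real.rpow_mul (norm_nonneg _)]
          have : γ * θ = β := by rw [hθ]; field_simp
          rw [this]; ring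

lemma aux_semi {n : ℕ} {α : ℝ} (hα : 0 < α) {Ω : Set (En n)} {a : En n → ℂ}
    (h : holderSemi α Ω a ≠ ⊤) : ∀ x ∈ Ω, ∀ y ∈ Ω,
      ‖a x - a y‖ ≤ (holderSemi α Ω a).toReal * ‖x - y‖ ^ α := by
  intro x hx y hy
  by_cases hxy : x = y
  · subst hxy
    simp [Real.zero_rpow hα.ne']
  · have hp : 0 < ‖x - y‖ := by simpa using sub_ne_zero.2 hxy
    have h1 : ENNReal.ofReal (‖a x - a y‖ / ‖x - y‖ ^ α) ≤ holderSemi α Ω a :=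
      le_iSup (fun p : Ω × Ω =>
        ENNReal.ofReal (‖a p.1.1 - a p.2.1‖ / ‖p.1.1 - p.2.1‖ ^ α)) (⟨x, hx⟩, ⟨y, hy⟩)
    have h2 := (ENNReal.ofReal_le_iff_le_toReal h).1 h1
    rwa [div_le_iff₀ (by positivity)] at h2

lemma aux_cont {n : ℕ} {α A : ℝ} (hα : 0 < α) {Ω : Set (En n)} {a : En n → ℂ}
    (h : ∀ x ∈ Ω, ∀ y ∈ Ω, ‖a x - a y‖ ≤ A * ‖x - y‖ ^ α) : ContinuousOn a Ω := by
  intro x hx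
  rw [ContinuousWithinAt, tendsto_iff_norm_sub_tendsto_zero]
  have hc : Tendsto (fun y : En n => A * ‖y - x‖ ^ α) (𝓝[Ω] x) (𝓝 0) := by
    have : Continuous (fun y : En n => A * ‖y - x‖ ^ α) :=
      continuous_const.mul ((by fun_prop : Continuous fun y : En n => ‖y - x‖).rpow_const
        fun _ => Or.inr hα.le)
    have h2 := this.tendsto x
    simp only [sub_self, norm_zero, Real.zero_rpow hα.ne', mul_zero] at h2
    exact h2.mono_left nhdsWithin_le_nhds
  refine squeeze_zero' (Eventually.of_forall fun _ => norm_nonneg _) ?_ hc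
  filter_upwards [self_mem_nhdsWithin] with y hy
  exact h y hy x hx

lemma aux_norm {n : ℕ} {β : ℝ} (hβ : 0 < β) {Ω : Set (En n)} {f : En n → ℂ}
    (h : holderNorm β Ω f ≤ 1) : (∀ x ∈ Ω, ‖f x‖ ≤ 1) ∧ ContinuousOn f Ω := by
  constructor
  · intro x hx
    have h1 : (‖f x‖₊ : ℝ≥0∞) ≤ 1 :=
      (le_iSup (fun x : Ω => (‖f x.1‖₊ : ℝ≥0∞)) ⟨x, hx⟩).trans (le_self_add.trans h)
    exact_mod_cast h1
  · have h1 : holderSemi β Ω f ≤ 1 := le_add_self.trans h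
    exact aux_cont hβ (aux_semi hβ (ne_top_of_le_ne_top ENNReal.one_ne_top h1))

lemma aux_integrable (n : ℕ) (hn : 0 < n) (Ω : Set (En n)) (hΩo : IsOpen Ω)
    (a f : En n → ℂ) (K : En n → ℝ) (ha : ContinuousOn a Ω) (hf : ContinuousOn f Ω)
    (hK : ContinuousOn K {(0 : En n)}ᶜ) (hf1 : ∀ x ∈ Ω, ‖f x‖ ≤ 1) (x : En n)
    (b : En n → ℝ) (hb : IntegrableOn b Ω)
    (hk : ∀ y ∈ Ω, ‖(a x - a y) * (K (x - y) : ℂ)‖ ≤ b y) :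
    IntegrableOn (fun y => (a x - a y) * (K (x - y) : ℂ) * f y) Ω := by
  have : Nonempty (Fin n) := ⟨⟨0, hn⟩⟩
  have : Nontrivial (En n) := inferInstance
  refine Integrable.mono' hb ?_ ?_
  · have hae : (volume : Measure (En n)).restrict Ω = volume.restrict (Ω \ {x}) :=
      Measure.restrict_congr_set (sdiff_null_ae_eq_self (measure_singleton x)).symm
    rw [hae]
    refine ContinuousOn.aestronglyMeasurable ?_ (hΩo.measurableSet.diff (measurableSet_singleton x))
    have h1 : ContinuousOn (fun y => K (x - y)) (Ω \ {x}) := by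
      refine hK.comp (by fun_prop) ?_
      intro y hy h0
      exact hy.2 (sub_eq_zero.1 h0).symm
    have ha' := ha.mono (sdiff_subset (t := {x}))
    have hf' := hf.mono (sdiff_subset (t := {x}))
    exact ((continuousOn_const.sub ha').mul (Complex.continuous_ofReal.comp_continuousOn h1)).mul hf'
  · filter_upwards [ae_restrict_mem hΩo.measurableSet] with y hy
    rw [norm_mul]
    calc _ ≤ ‖(a x - a y) * (K (x - y) : ℂ)‖ * 1 := by
          gcongr
          exact hf1 y hy
      _ ≤ _ := by rw [mul_one]; exact hk y hy

/-- For a bounded `C^{1+ε}` domain `Ω ⊆ ℝ^n`, an even smooth homogeneous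
Calderón–Zygmund operator with kernel `K`, `0 < α < 1`, `0 < β ≤ ε` with `β < α`, and a
function `a` with finite `σ_α(a)`, the commutator `[T,a]` is compact from `Lip(β,Ω)` into
itself: every sequence in the unit ball of `Lip(β,Ω)` has a subsequence whose image under
`[T,a]` converges in `‖·‖_{β,Ω}`. -/
theorem statement8 (n : ℕ) (ε α β : ℝ) (hε0 : 0 < ε) (hε1 : ε < 1)
    (hα0 : 0 < α) (hα1 : α < 1) (hβ0 : 0 < β) (hβε : β ≤ ε) (hβα : β < α)
    (Ω : Set (En n)) (hΩo : IsOpen Ω) (hΩc : IsConnected Ω)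
    (hΩb : Bornology.IsBounded Ω) (hΩ : HasC1HolderBoundary n ε Ω) :
    ∀ ω K : En n → ℝ,
      (∀ x, x ≠ 0 → K x = ω x / ‖x‖ ^ n) →
      (∀ t : ℝ, 0 < t → ∀ x, ω (t • x) = ω x) →
      (∀ x, ω (-x) = ω x) →
      ContDiffOn ℝ 1 ω {(0 : En n)}ᶜ →
      (∫ ξ in sphere (0 : En n) 1, ω ξ ∂μH[(n : ℝ) - 1]) = 0 →
      ∀ a : En n → ℂ, holderSemi α Ω a ≠ ⊤ →
        ∀ f : ℕ → En n → ℂ, (∀ k, holderNorm β Ω (f k) ≤ 1) →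
          ∃ φ : ℕ → ℕ, StrictMono φ ∧
            ∃ g : En n → ℂ,
              Tendsto
                (fun j => holderNorm β Ω
                  ((fun x => ∫ y in Ω, (a x - a y) * (K (x - y) : ℂ) * f (φ j) y) - g))
                atTop (𝓝 0) := by
  intro ω K hK hω _ hωC _ a ha f hf
  obtain ⟨hn, -⟩ := hΩ
  obtain ⟨hKc, C, hC, hK1, hK2⟩ := aux_kernel n ω K hK hω hωC
  set A := (holderSemi α Ω a).toReal with hA
  have hA0 : 0 ≤ A := ENNReal.toReal_nonneg
  have haA := aux_semi hα0 ha
  have hac := aux_cont hα0 haA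
  obtain ⟨γ, hβγ, hγα⟩ := exists_between hβα
  have hγ0 : 0 < γ := hβ0.trans hβγ
  obtain ⟨P1, P2⟩ := aux_point n hn α γ A C hγ0 hγα hα1 hA0 hC Ω a K haA hK1 hK2
  obtain ⟨I, hI, hI'⟩ := aux_potential n hn α hα0 Ω hΩb
  obtain ⟨J, hJ, hJ'⟩ := aux_potential n hn (α - γ) (by linarith) Ω hΩb
  have hint : ∀ k, ∀ x ∈ Ω,
      IntegrableOn (fun y => (a x - a y) * (K (x - y) : ℂ) * f k y) Ω := by
    intro k x hx
    obtain ⟨h1, h2⟩ := aux_norm hβ0 (hf k)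
    exact aux_integrable n hn Ω hΩo a (f k) K hac h2 hKc h1 x _ ((hI' x hx).1.const_mul (A * C))
      (P1 x hx)
  refine aux_compact n β γ (A * C * I + 3 * (A * C) * (J + J)) hβ0 hβγ (by positivity) Ω
    hΩc.nonempty hΩb (fun k x => ∫ y in Ω, (a x - a y) * (K (x - y) : ℂ) * f k y) ?_ ?_
  · intro k x hx
    have h1 := (aux_norm hβ0 (hf k)).1
    calc _ ≤ ∫ y in Ω, A * C * ‖x - y‖ ^ (α - n) := by
          refine norm_integral_le_of_norm_le ((hI' x hx).1.const_mul (A * C)) ?_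
          filter_upwards [ae_restrict_mem hΩo.measurableSet] with y hy
          rw [norm_mul]
          exact (mul_le_of_le_one_right (norm_nonneg _) (h1 y hy)).trans (P1 x hx y hy)
      _ = A * C * ∫ y in Ω, ‖x - y‖ ^ (α - n) := integral_const_mul _ _
      _ ≤ A * C * I := by
          gcongr
          exact (hI' x hx).2
      _ ≤ _ := le_add_of_nonneg_right (by positivity)
  · intro k x hx x' hx'
    have h1 := (aux_norm hβ0 (hf k)).1
    have hi := (hJ' x hx).1.add (hJ' x' hx').1
    rw [← integral_sub (hint k x hx) (hint k x' hx')]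
    calc _ ≤ ∫ y in Ω, 3 * (A * C) * ‖x - x'‖ ^ γ *
            (‖x - y‖ ^ (α - γ - n) + ‖x' - y‖ ^ (α - γ - n)) := by
          refine norm_integral_le_of_norm_le (hi.const_mul (3 * (A * C) * ‖x - x'‖ ^ γ)) ?_
          filter_upwards [ae_restrict_mem hΩo.measurableSet] with y hy
          rw [← sub_mul, norm_mul]
          exact (mul_le_of_le_one_right (norm_nonneg _) (h1 y hy)).trans (P2 x hx x' hx' y hy)
      _ = 3 * (A * C) * ‖x - x'‖ ^ γ * ((∫ y in Ω, ‖x - y‖ ^ (α - γ - n))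
            + ∫ y in Ω, ‖x' - y‖ ^ (α - γ - n)) := by
          rw [integral_const_mul, integral_add (hJ' x hx).1 (hJ' x' hx').1]
      _ ≤ 3 * (A * C) * ‖x - x'‖ ^ γ * (J + J) := by
          gcongr
          · exact (hJ' x hx).2
          · exact (hJ' x' hx').2
      _ = (3 * (A * C) * (J + J)) * ‖x - x'‖ ^ γ := by ring
      _ ≤ _ := by
          gcongr
          exact le_add_of_nonneg_left (by positivity)

end
end

section
/- Let Ω ⊂ ℂ be a bounded domain with boundary of class C^{1+ε}, 0 < ε < 1, and let n ≥ 1 be an integer. Then the kernel K_n(z,ζ) = ∫_{ℂ∖Ω} (z−w)^{−2} · n (conj(w−ζ))^{n−1} (w−ζ)^{−(n+1)} dA(w) satisfies |K_n(z,ζ)| ≤ C |z − ζ|^{−2+ε} for all z, ζ ∈ Ω with z ≠ ζ, where C depends only on n, ε and Ω. -/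
open MeasureTheory Metric Set Filter Topology Complex
open scoped ENNReal NNReal

noncomputable section

/-- `Ω ⊆ ℂ` has boundary of class `C^{1+ε}`: near each boundary point, after a rotation of
coordinates, `Ω` is the subgraph of a `C^1` function whose derivative is `ε`-Hölder. -/
def HasC1HolderBoundaryC (ε : ℝ) (Ω : Set ℂ) : Prop :=
  ∀ a ∈ frontier Ω, ∃ r > 0, ∃ e : ℂ, ‖e‖ = 1 ∧ ∃ φ : ℝ → ℝ,
    ContDiff ℝ 1 φ ∧
    (∃ c : ℝ≥0, HolderOnWith c ε.toNNReal (deriv φ) univ) ∧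
    Ω ∩ ball a r = {z ∈ ball a r | (e * z).im < φ ((e * z).re)}

/-- The kernel `K_n(z,ζ) = ∫_{ℂ∖Ω} (z−w)^{−2} · n conj(w−ζ)^{n−1} (w−ζ)^{−(n+1)} dA(w)`. -/
def Kker (Ω : Set ℂ) (n : ℕ) (z ζ : ℂ) : ℂ :=
  ∫ w in Ωᶜ,
    ((z - w) ^ 2)⁻¹ * ((n : ℂ) * (starRingEnd ℂ) (w - ζ) ^ (n - 1) / (w - ζ) ^ (n + 1))

def hker (ε ρ : ℝ) : ℝ := ρ ^ (ε - 2) * (max ρ 1 ^ 2)⁻¹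

lemma hker_nonneg {ε ρ : ℝ} (h : 0 ≤ ρ) : 0 ≤ hker ε ρ := by
  unfold hker; positivity

lemma hker_integrable {ε : ℝ} (h0 : 0 < ε) (h1 : ε < 1) :
    Integrable (fun w : ℂ => hker ε ‖w‖) := by
  rw [integrable_fun_norm_addHaar volume]
  rw [← Ioc_union_Ioi_eq_Ioi (zero_le_one (α := ℝ))]
  apply IntegrableOn.union
  · have : IntegrableOn (fun y : ℝ => y ^ (ε - 1)) (Ioc 0 1) := by
      rw [← intervalIntegrable_iff_integrableOn_Ioc_of_le zero_le_one]
      exact intervalIntegral.intervalIntegrable_rpow' (by linarith)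
    refine this.congr_fun ?_ measurableSet_Ioc
    intro y hy
    have : y ^ (ε - 1) = y * y ^ (ε - 2) := by
      rw [← Real.rpow_one_add' hy.1.le (by linarith)]; ring_nf
    simp [hker, max_eq_right hy.2, this]
  · have : IntegrableOn (fun y : ℝ => y ^ (ε - 3)) (Ioi 1) :=
      integrableOn_Ioi_rpow_of_lt (by linarith) one_pos
    refine this.congr_fun ?_ measurableSet_Ioi
    intro y hy
    have hy' : (1:ℝ) < y := hy
    have hy0 : 0 < y := by linarith
    have : y ^ (ε - 3) = y ^ (ε - 2) * y⁻¹ := by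
      rw [← Real.rpow_neg_one, ← Real.rpow_add hy0]; ring_nf
    simp only [hker, max_eq_left hy'.le, this, Complex.finrank_real_complex, smul_eq_mul]
    field_simp
    norm_num

/-- the absolute estimate -/
lemma kernel_int {ε : ℝ} (h0 : 0 < ε) (h1 : ε < 1) : ∃ A : ℝ, 0 < A ∧ ∀ z ζ : ℂ, z ≠ ζ →
    ∃ b : ℂ → ℝ, Integrable b ∧ (∫ w, b w) ≤ A * ‖z - ζ‖ ^ (-2 + ε) ∧ (∀ w, 0 ≤ b w) ∧
      ∀ w, w ≠ z → w ≠ ζ → ∀ m : ℝ, m ≤ ‖w - z‖ ^ ε → m ≤ ‖w - ζ‖ ^ ε →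
        (‖w - z‖ ^ 2)⁻¹ * (‖w - ζ‖ ^ 2)⁻¹ * m ≤ b w := by
  set J := ∫ w : ℂ, hker ε ‖w‖
  have hJ : 0 ≤ J := integral_nonneg fun w => hker_nonneg (norm_nonneg _)
  refine ⟨2 * (2⁻¹ : ℝ) ^ (ε - 2) * (J + 1), by positivity, ?_⟩
  intro z ζ hne
  have hd : 0 < ‖z - ζ‖ := norm_pos_iff.2 (sub_ne_zero.2 hne)
  set d := ‖z - ζ‖ / 2 with hdd
  have hd2 : 0 < d := by positivity
  have key : ∀ p : ℂ, Integrable (fun w : ℂ => d ^ (ε - 4) * hker ε (‖w - p‖ / d)) ∧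
      ∫ w : ℂ, d ^ (ε - 4) * hker ε (‖w - p‖ / d) = d ^ (ε - 2) * J := by
    intro p
    have e1 : ∀ w : ℂ, ‖w - p‖ / d = ‖d⁻¹ • (w - p)‖ := by
      intro w; rw [norm_smul, Real.norm_of_nonneg (by positivity)]; field_simp
    constructor
    · refine Integrable.const_mul ?_ _
      simp_rw [e1]
      exact ((hker_integrable h0 h1).comp_smul (inv_ne_zero hd2.ne')).comp_sub_right p
    · rw [integral_const_mul]
      simp_rw [e1]
      rw [integral_sub_right_eq_self (fun w : ℂ => hker ε ‖d⁻¹ • w‖) p,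
        Measure.integral_comp_smul volume (fun w : ℂ => hker ε ‖w‖)]
      rw [Complex.finrank_real_complex, abs_of_pos (by positivity), smul_eq_mul, ← mul_assoc]
      congr 1
      have : d ^ (ε - 2) = d ^ (ε - 4) * d ^ (2:ℝ) := by
        rw [← Real.rpow_add hd2]; ring_nf
      rw [this]; norm_num
  refine ⟨fun w => d ^ (ε - 4) * hker ε (‖w - z‖ / d) + d ^ (ε - 4) * hker ε (‖w - ζ‖ / d),
    (key z).1.add (key ζ).1, ?_, ?_, ?_⟩
  · rw [integral_add (key z).1 (key ζ).1, (key z).2, (key ζ).2]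
    have : d ^ (ε - 2) = (2⁻¹ : ℝ) ^ (ε - 2) * ‖z - ζ‖ ^ (-2 + ε) := by
      rw [hdd, div_eq_inv_mul, Real.mul_rpow (by positivity) (by positivity)]; ring_nf
    rw [this]
    have : 0 ≤ (2⁻¹ : ℝ) ^ (ε - 2) * ‖z - ζ‖ ^ (-2 + ε) := by positivity
    nlinarith
  · intro w
    have := hker_nonneg (ε := ε) (ρ := ‖w - z‖ / d) (by positivity)
    have := hker_nonneg (ε := ε) (ρ := ‖w - ζ‖ / d) (by positivity)
    positivity
  · -- symmetric pointwise bound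
    have main : ∀ x y : ℝ, 0 < x → x ≤ y → d ≤ y → ∀ m, m ≤ x ^ ε →
        (x ^ 2)⁻¹ * (y ^ 2)⁻¹ * m ≤ d ^ (ε - 4) * hker ε (x / d) := by
      intro x y hx hxy hdy m hm
      have hy : 0 < y := by linarith
      have e : d ^ (ε - 4) * hker ε (x / d) = x ^ (ε - 2) * (max x d ^ 2)⁻¹ := by
        unfold hker
        have : max (x / d) 1 = max x d / d := by
          rw [← max_div_div_right hd2.le, div_self hd2.ne']
        rw [this, Real.div_rpow hx.le hd2.le]
        have : d ^ (ε - 2) = d ^ (ε - 4) * d ^ 2 := by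
          rw [← Real.rpow_natCast, ← Real.rpow_add hd2]; norm_num; ring_nf
        rw [this]
        have : 0 < d ^ (ε - 4) := by positivity
        have : 0 < max x d := by positivity
        field_simp
      rw [e]
      have e2 : x ^ (ε - 2) = (x ^ 2)⁻¹ * x ^ ε := by
        rw [Real.rpow_sub hx]; norm_num; field_simp
      rw [e2, mul_assoc, mul_assoc, mul_comm (x ^ ε)]
      have : max x d ≤ y := max_le hxy hdy
      have : 0 < max x d := by positivity
      have hm' : (y ^ 2)⁻¹ * m ≤ (y ^ 2)⁻¹ * x ^ ε := by gcongr
      refine mul_le_mul_of_nonneg_left (hm'.trans ?_) (by positivity)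
      gcongr
    intro w hwz hwζ m hm1 hm2
    have a1 : 0 < ‖w - z‖ := norm_pos_iff.2 (sub_ne_zero.2 hwz)
    have a2 : 0 < ‖w - ζ‖ := norm_pos_iff.2 (sub_ne_zero.2 hwζ)
    have tri : ‖z - ζ‖ ≤ ‖w - z‖ + ‖w - ζ‖ := by
      have : z - ζ = (w - ζ) - (w - z) := by ring
      rw [this, add_comm]; exact norm_sub_le _ _
    have p1 : 0 ≤ d ^ (ε - 4) * hker ε (‖w - z‖ / d) :=
      mul_nonneg (by positivity) (hker_nonneg (by positivity))
    have p2 : 0 ≤ d ^ (ε - 4) * hker ε (‖w - ζ‖ / d) :=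
      mul_nonneg (by positivity) (hker_nonneg (by positivity))
    rcases le_total ‖w - z‖ ‖w - ζ‖ with h | h
    · have := main _ _ a1 h (by rw [hdd]; linarith) m hm1
      linarith
    · have := main _ _ a2 h (by rw [hdd]; linarith) m hm2
      rw [mul_comm (‖w - z‖ ^ 2)⁻¹]
      linarith

lemma exists_frontier {s : Set ℂ} {p q : ℂ} (hp : p ∈ s) (hq : q ∉ s) :
    ∃ r ∈ frontier s, ‖p - r‖ ≤ ‖p - q‖ ∧ ‖q - r‖ ≤ ‖p - q‖ := by
  by_contra! hcon
  have hd : ∀ r ∈ segment ℝ p q, r ∉ frontier s := by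
    intro r hr hf
    have h1 := dist_add_dist_of_mem_segment hr
    simp only [dist_eq_norm] at h1
    have := hcon r hf (by linarith [norm_nonneg (r - q)])
    rw [norm_sub_rev q r] at this
    linarith [norm_nonneg (p - r)]
  have hc : IsPreconnected (segment ℝ p q) := (convex_segment p q).isPreconnected
  have := hc (interior s) (interior sᶜ) isOpen_interior isOpen_interior ?_ ?_ ?_
  · obtain ⟨x, -, hx1, hx2⟩ := this
    exact interior_subset hx2 (interior_subset hx1)
  · intro r hr
    have := hd r hr
    by_contra h
    simp only [mem_union, not_or, interior_compl, mem_compl_iff, not_not] at h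
    exact this ⟨h.2, h.1⟩
  · refine ⟨p, left_mem_segment _ _ _, ?_⟩
    by_contra h
    exact hd p (left_mem_segment _ _ _) ⟨subset_closure hp, h⟩
  · refine ⟨q, right_mem_segment _ _ _, ?_⟩
    by_contra h
    rw [interior_compl, mem_compl_iff, not_not] at h
    exact hd q (right_mem_segment _ _ _) ⟨h, fun hh => hq (interior_subset hh)⟩

lemma lip_glue {s : Set ℂ} {f : ℂ → ℂ} {K : ℝ≥0} (hs : IsClosed s) (hf : LipschitzOnWith K f s)
    (h0 : ∀ w ∈ frontier s, f w = 0) (h1 : ∀ w ∉ s, f w = 0) : LipschitzWith K f := by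
  have aux : ∀ p ∈ s, ∀ q ∉ s, ‖f p - f q‖ ≤ K * ‖p - q‖ := by
    intro p hp q hq
    obtain ⟨r, hr, h, -⟩ := exists_frontier hp hq
    have := hf.dist_le_mul p hp r (hs.frontier_subset hr)
    rw [dist_eq_norm, dist_eq_norm] at this
    rw [h1 q hq, ← h0 r hr]
    exact this.trans (by gcongr)
  refine LipschitzWith.of_dist_le_mul fun p q => ?_
  by_cases hp : p ∈ s <;> by_cases hq : q ∈ s
  · exact hf.dist_le_mul p hp q hq
  · simpa [dist_eq_norm] using aux p hp q hq
  · rw [dist_comm, dist_comm p]; simpa [dist_eq_norm] using aux q hq p hp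
  · rw [h1 p hp, h1 q hq, dist_self]; positivity

def db (A : ℂ →L[ℝ] ℂ) : ℂ := (A 1 + I * A I) / 2

lemma db_add (A B : ℂ →L[ℝ] ℂ) : db (A + B) = db A + db B := by simp [db]; ring
lemma db_sub (A B : ℂ →L[ℝ] ℂ) : db (A - B) = db A - db B := by simp [db]; ring
lemma db_smul (c : ℂ) (A : ℂ →L[ℝ] ℂ) : db (c • A) = c * db A := by simp [db]; ring
lemma db_zero : db 0 = 0 := by simp [db]
lemma db_conj : db (conjCLE : ℂ →L[ℝ] ℂ) = 1 := by simp [db]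
lemma db_holo (A : ℂ →L[ℂ] ℂ) : db (A.restrictScalars ℝ) = 0 := by
  have : A I = I * A 1 := by rw [← smul_eq_mul, ← map_smul]; simp
  simp only [db, ContinuousLinearMap.coe_restrictScalars', this, ← mul_assoc, I_mul_I]; simp

lemma norm_db (A : ℂ →L[ℝ] ℂ) : ‖db A‖ ≤ ‖A‖ := by
  have h1 := A.le_opNorm 1
  have h2 := A.le_opNorm I
  have : ‖db A‖ = ‖A 1 + I * A I‖ / 2 := by simp [db]
  have h3 := norm_add_le (A 1) (I * A I)
  simp at h1 h2 h3
  linarith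

lemma int_lineDeriv_zero {f : ℂ → ℝ} {K : ℝ≥0} (hf : LipschitzWith K f) (hc : HasCompactSupport f)
    (v : ℂ) : ∫ w, lineDeriv ℝ f w v = 0 := by
  have := (LipschitzWith.const' (1:ℝ) (α := ℂ) (K := 0)).integral_lineDeriv_mul_eq
    (μ := volume) hf hc (-v)
  simpa [lineDeriv] using this.symm

lemma int_fderiv {f : ℂ → ℂ} {K : ℝ≥0} (hf : LipschitzWith K f) (hc : HasCompactSupport f)
    (v : ℂ) : Integrable (fun w => fderiv ℝ f w v) ∧ ∫ w, fderiv ℝ f w v = 0 := by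
  have hI : Integrable (fun w => fderiv ℝ f w v) := by
    have hs : HasCompactSupport (fun w => fderiv ℝ f w v) := hc.fderiv_apply ℝ v
    have hm : Measurable (fun w => fderiv ℝ f w v) := measurable_fderiv_apply_const ℝ f v
    rw [← integrableOn_iff_integrable_of_support_subset (subset_tsupport _)]
    refine Measure.integrableOn_of_bounded (M := K * ‖v‖) hs.isCompact.measure_lt_top.ne
      hm.aestronglyMeasurable ?_
    refine Eventually.of_forall fun w => ?_
    exact ((fderiv ℝ f w).le_opNorm v).trans (by
      gcongr; exact norm_fderiv_le_of_lipschitz ℝ hf)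
  refine ⟨hI, ?_⟩
  have hae := hf.ae_differentiableAt (μ := volume)
  have hre : ∫ w, (fderiv ℝ f w v).re = 0 := by
    rw [← int_lineDeriv_zero (f := fun w => (f w).re) (K := 1 * K)
      (LipschitzWith.comp (f := re) ?_ hf) (hc.comp_left (g := re) rfl) v]
    · apply integral_congr_ae
      filter_upwards [hae] with w hw
      have : HasFDerivAt (fun w => (f w).re) (reCLM ∘L fderiv ℝ f w) w :=
        reCLM.hasFDerivAt.comp w hw.hasFDerivAt
      rw [this.hasLineDerivAt v |>.lineDeriv]; rfl
    · exact LipschitzWith.of_dist_le_mul fun p q => by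
        simpa [dist_eq_norm] using abs_re_le_norm (p - q)
  have him : ∫ w, (fderiv ℝ f w v).im = 0 := by
    rw [← int_lineDeriv_zero (f := fun w => (f w).im) (K := 1 * K)
      (LipschitzWith.comp (f := im) ?_ hf) (hc.comp_left (g := im) rfl) v]
    · apply integral_congr_ae
      filter_upwards [hae] with w hw
      have : HasFDerivAt (fun w => (f w).im) (imCLM ∘L fderiv ℝ f w) w :=
        imCLM.hasFDerivAt.comp w hw.hasFDerivAt
      rw [this.hasLineDerivAt v |>.lineDeriv]; rfl
    · exact LipschitzWith.of_dist_le_mul fun p q => by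
        simpa [dist_eq_norm] using abs_im_le_norm (p - q)
  apply Complex.ext
  · rw [← reCLM_apply, ← reCLM.integral_comp_comm hI]; simpa using hre
  · rw [← imCLM_apply, ← imCLM.integral_comp_comm hI]; simpa using him

lemma int_db {f : ℂ → ℂ} {K : ℝ≥0} (hf : LipschitzWith K f) (hc : HasCompactSupport f) :
    Integrable (fun w => db (fderiv ℝ f w)) ∧ ∫ w, db (fderiv ℝ f w) = 0 := by
  obtain ⟨i1, e1⟩ := int_fderiv hf hc 1
  obtain ⟨i2, e2⟩ := int_fderiv hf hc I
  unfold db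
  refine ⟨(i1.add (i2.const_mul I)).div_const 2, ?_⟩
  rw [integral_div, integral_add i1 (i2.const_mul I), integral_const_mul, e1, e2]; simp

set_option maxHeartbeats 1000000 in
lemma propB {ε : ℝ} (hε0 : 0 < ε) (hε1 : ε < 1) {n : ℕ} (hn : 1 ≤ n)
    {Ω : Set ℂ} (hΩo : IsOpen Ω) (hnull : volume (frontier Ω) = 0)
    {L : ℝ≥0} {C B : ℝ} {R : ℂ → ℂ} (hL : LipschitzWith L R)
    (hR : ∀ w ∈ Ω, R w = (starRingEnd ℂ) w) (hB : ∀ w, B < ‖w‖ → R w = (starRingEnd ℂ) w)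
    (hC0 : 0 ≤ C)
    (hC : ∀ w ∉ closure Ω, DifferentiableAt ℝ R w ∧
      ∀ q ∈ Ω, ‖db (fderiv ℝ R w)‖ ≤ C * ‖w - q‖ ^ ε) :
    ∃ C : ℝ, 0 < C ∧ ∀ z ∈ Ω, ∀ ζ ∈ Ω, z ≠ ζ →
        ‖Kker Ω n z ζ‖ ≤ C * ‖z - ζ‖ ^ (-2 + ε) := by
  obtain ⟨A, hA, hker⟩ := kernel_int hε0 hε1
  refine ⟨(n * L ^ (n - 1) * C + 1) * A, by positivity, ?_⟩
  intro z hz ζ hζ hne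
  have hd : 0 < ‖z - ζ‖ := norm_pos_iff.2 (sub_ne_zero.2 hne)
  obtain ⟨b, hbI, hbA, hb0, hb⟩ := hker z ζ hne
  set M : ℝ := n * L ^ (n - 1) * C + 1 with hM
  have hM0 : 0 < M := by positivity
  set k : ℂ → ℂ := fun w => ((z - w) ^ 2)⁻¹ *
    ((n : ℂ) * (starRingEnd ℂ) (w - ζ) ^ (n - 1) / (w - ζ) ^ (n + 1)) with hk
  change ‖∫ w in Ωᶜ, k w‖ ≤ _
  by_cases hkI : IntegrableOn k Ωᶜ
  swap
  · rw [integral_undef hkI]; simp; positivity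
  set c : ℂ := (starRingEnd ℂ) ζ
  set g : ℂ → ℂ := fun w => ((z - w) ^ 2)⁻¹ * ((w - ζ) ^ (n + 1))⁻¹ with hg
  set u : ℂ → ℂ := fun w => g w * (((starRingEnd ℂ) w - c) ^ n - (R w - c) ^ n) with hu
  have hneΩ : ∀ w ∉ Ω, z - w ≠ 0 ∧ w - ζ ≠ 0 := by
    intro w hw
    exact ⟨fun h => hw (by rwa [← sub_eq_zero.1 h]), fun h => hw (by rwa [sub_eq_zero.1 h])⟩
  have hu0 : ∀ w, R w = (starRingEnd ℂ) w → u w = 0 := by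
    intro w hw; simp [hu, hw]
  have hRcl : ∀ w ∈ closure Ω, R w = (starRingEnd ℂ) w := by
    have : IsClosed {w | R w = (starRingEnd ℂ) w} :=
      isClosed_eq hL.continuous Complex.continuous_conj
    exact fun w hw => (this.closure_subset_iff (s := Ω)).2 hR hw
  set s : Set ℂ := Ωᶜ ∩ closedBall 0 B with hs
  have hsc : IsCompact s := (isCompact_closedBall _ _).inter_left hΩo.isClosed_compl
  have hRs : ∀ w ∉ s, R w = (starRingEnd ℂ) w := by
    intro w hw
    by_cases h : w ∈ Ω
    · exact hR w h
    · apply hB; by_contra! hh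
      exact hw ⟨h, by simpa using hh⟩
  have hRf : ∀ w ∈ frontier s, R w = (starRingEnd ℂ) w := by
    have : IsClosed {w | R w = (starRingEnd ℂ) w} :=
      isClosed_eq hL.continuous Complex.continuous_conj
    intro w hw
    rw [frontier_eq_closure_inter_closure] at hw
    exact (this.closure_subset_iff (s := sᶜ)).2 hRs hw.2
  have hloc : LocallyLipschitzOn s u := by
    intro w hw
    obtain ⟨h1, h2⟩ := hneΩ w hw.1
    have hΨ : ContDiffAt ℝ 1 (fun p : ℂ × ℂ => (((z - p.1) ^ 2)⁻¹ * ((p.1 - ζ) ^ (n + 1))⁻¹) *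
        ((conjCLE p.1 - c) ^ n - (p.2 - c) ^ n)) (w, R w) := by
      have e1 : ContDiffAt ℝ 1 (fun p : ℂ × ℂ => conjCLE p.1) (w, R w) :=
        conjCLE.contDiff.contDiffAt.comp _ contDiffAt_fst
      refine ContDiffAt.mul (ContDiffAt.mul (ContDiffAt.inv ?_ ?_) (ContDiffAt.inv ?_ ?_))
        (((e1.sub contDiffAt_const).pow n).sub ((contDiffAt_snd.sub contDiffAt_const).pow n))
      · exact (contDiffAt_const.sub contDiffAt_fst).pow 2
      · exact pow_ne_zero _ h1
      · exact (contDiffAt_fst.sub contDiffAt_const).pow _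
      · exact pow_ne_zero _ h2
    obtain ⟨K, t, ht, hK⟩ := hΨ.exists_lipschitzOnWith
    have hp : LipschitzWith (max 1 L) (fun w => (w, R w)) := LipschitzWith.id.prodMk hL
    refine ⟨K * max 1 L, (fun w => (w, R w)) ⁻¹' t,
      mem_nhdsWithin_of_mem_nhds (hp.continuous.continuousAt ht), ?_⟩
    have hcomp := hK.comp (hp.lipschitzOnWith (s := (fun w => (w, R w)) ⁻¹' t))
      (Set.mapsTo_preimage _ _)
    intro x hx y hy
    have h := hcomp hx hy
    simp only [Function.comp, conjCLE_apply] at h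
    exact h
  obtain ⟨K, hK⟩ := hloc.exists_lipschitzOnWith_of_compact hsc
  have huL : LipschitzWith K u := lip_glue hsc.isClosed hK (fun w hw => hu0 w (hRf w hw))
    (fun w hw => hu0 w (hRs w hw))
  have huc : HasCompactSupport u := by
    refine HasCompactSupport.intro hsc fun w hw => hu0 w (hRs w hw)
  obtain ⟨hI, hint⟩ := int_db huL huc
  -- the derivative inside Ω vanishes
  have hin : ∀ w ∈ Ω, db (fderiv ℝ u w) = 0 := by
    intro w hw
    have : u =ᶠ[𝓝 w] fun _ => 0 := by
      filter_upwards [hΩo.mem_nhds hw] with x hx using hu0 x (hR x hx)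
    rw [this.fderiv_eq]; simp [db_zero]
  have hint' : ∫ w in Ωᶜ, db (fderiv ℝ u w) = 0 := by
    rw [← hint]
    apply setIntegral_eq_integral_of_forall_compl_eq_zero
    intro w hw; exact hin w (by simpa using hw)
  have hout : ∀ w ∉ closure Ω, k w - db (fderiv ℝ u w) =
      g w * (n * (R w - c) ^ (n - 1) * db (fderiv ℝ R w)) := by
    intro w hw
    obtain ⟨h1, h2⟩ := hneΩ w (fun h => hw (subset_closure h))
    have hg' : DifferentiableAt ℂ g w := by
      refine DifferentiableAt.mul (DifferentiableAt.inv ?_ (pow_ne_zero _ h1))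
        (DifferentiableAt.inv ?_ (pow_ne_zero _ h2)) <;> fun_prop
    have hgd : HasFDerivAt g ((fderiv ℂ g w).restrictScalars ℝ) w :=
      hg'.hasFDerivAt.restrictScalars ℝ
    have hcd : HasFDerivAt (fun w : ℂ => (starRingEnd ℂ) w - c) (conjCLE : ℂ →L[ℝ] ℂ) w :=
      (conjCLE.hasFDerivAt (x := w)).sub_const c
    have hRd : HasFDerivAt (fun w : ℂ => R w - c) (fderiv ℝ R w) w :=
      (hC w hw).1.hasFDerivAt.sub_const c
    have := hgd.mul ((hcd.pow n).sub (hRd.pow n))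
    have hfu := HasFDerivAt.fderiv (f := u) this
    rw [hfu, db_add, db_smul, db_smul, db_sub, db_smul, db_smul, db_holo, db_conj]
    simp only [hk, hg, nsmul_eq_mul, map_sub]
    ring
  have hae : ∀ᵐ w ∂(volume.restrict Ωᶜ), ‖k w - db (fderiv ℝ u w)‖ ≤ M * b w := by
    rw [ae_restrict_iff' hΩo.measurableSet.compl]
    have : ∀ᵐ w : ℂ, w ∉ frontier Ω := measure_eq_zero_iff_ae_notMem.1 hnull
    filter_upwards [this] with w hwf hwΩ
    have hw : w ∉ closure Ω := fun h => hwf ⟨h, by rwa [hΩo.interior_eq]⟩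
    obtain ⟨h1, h2⟩ := hneΩ w hwΩ
    rw [hout w hw]
    have hS : ‖R w - c‖ ≤ L * ‖w - ζ‖ := by
      have := hL.dist_le_mul w ζ
      rwa [dist_eq_norm, dist_eq_norm, hR ζ hζ] at this
    have h2' : 0 < ‖w - ζ‖ := norm_pos_iff.2 h2
    have h1' : 0 < ‖w - z‖ := by rw [norm_sub_rev]; exact norm_pos_iff.2 h1
    have hbb := hb w (by rintro rfl; simp at h1) (by rintro rfl; simp at h2)
      (min (‖w - z‖ ^ ε) (‖w - ζ‖ ^ ε)) (min_le_left _ _) (min_le_right _ _)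
    have hdbm : ‖db (fderiv ℝ R w)‖ ≤ C * min (‖w - z‖ ^ ε) (‖w - ζ‖ ^ ε) := by
      rw [mul_min_of_nonneg _ _ hC0]
      exact le_min ((hC w hw).2 z hz) ((hC w hw).2 ζ hζ)
    set mm := min (‖w - z‖ ^ ε) (‖w - ζ‖ ^ ε) with hmm
    have hm0 : 0 ≤ mm := by positivity
    calc ‖g w * (n * (R w - c) ^ (n - 1) * db (fderiv ℝ R w))‖
        = ((‖w - z‖ ^ 2)⁻¹ * (‖w - ζ‖ ^ (n + 1))⁻¹) *
            (n * ‖R w - c‖ ^ (n - 1) * ‖db (fderiv ℝ R w)‖) := by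
          simp [hg, norm_sub_rev z w]
      _ ≤ ((‖w - z‖ ^ 2)⁻¹ * (‖w - ζ‖ ^ (n + 1))⁻¹) *
            (n * (L * ‖w - ζ‖) ^ (n - 1) * (C * mm)) := by gcongr
      _ = (n * L ^ (n - 1) * C) * ((‖w - z‖ ^ 2)⁻¹ * (‖w - ζ‖ ^ 2)⁻¹ * mm) := by
          obtain ⟨j, rfl⟩ : ∃ j, n = j + 1 := ⟨n - 1, by omega⟩
          simp only [Nat.add_sub_cancel]
          rw [mul_pow, show j + 1 + 1 = j + 2 by ring, pow_add]
          field_simp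
      _ ≤ (n * L ^ (n - 1) * C) * b w := by gcongr
      _ ≤ M * b w := by
          rw [hM]; have := hb0 w; nlinarith
  calc ‖∫ w in Ωᶜ, k w‖ = ‖∫ w in Ωᶜ, (k w - db (fderiv ℝ u w))‖ := by
        rw [integral_sub hkI hI.integrableOn, hint', sub_zero]
    _ ≤ ∫ w in Ωᶜ, M * b w := norm_integral_le_of_norm_le (hbI.const_mul M).integrableOn hae
    _ ≤ ∫ w, M * b w := setIntegral_le_integral (hbI.const_mul M)
        (Eventually.of_forall fun w => mul_nonneg hM0.le (hb0 w))
    _ = M * ∫ w, b w := integral_const_mul _ _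
    _ ≤ M * (A * ‖z - ζ‖ ^ (-2 + ε)) := by gcongr
    _ = _ := by ring

lemma local_t {r : ℝ} {Ω : Set ℂ} (hΩo : IsOpen Ω) {a e : ℂ} (ha : a ∈ frontier Ω) (hr : 0 < r)
    {φ : ℝ → ℝ} (hφ : ContDiff ℝ 1 φ)
    (hs : Ω ∩ ball a r = {z ∈ ball a r | (e * z).im < φ ((e * z).re)}) :
    (∀ w ∈ frontier Ω ∩ ball a r, (e * w).im - φ (e * w).re = 0) ∧
    ∃ L : ℝ, 0 ≤ L ∧ ∀ w ∈ ball a (r / 2), w ∉ Ω → 0 ≤ (e * w).im - φ (e * w).re ∧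
      (e * w).im - φ (e * w).re ≤ L ∧
      ∀ q ∈ Ω, (e * w).im - φ (e * w).re ≤ L * ‖w - q‖ := by
  set t : ℂ → ℝ := fun w => (e * w).im - φ (e * w).re with ht
  have htc : ContDiff ℝ 1 t := by
    have h1 : ContDiff ℝ 1 (fun w : ℂ => e * w) := contDiff_const.mul contDiff_id
    exact (imCLM.contDiff.comp h1).sub (hφ.comp (reCLM.contDiff.comp h1))
  have hΩt : ∀ w ∈ ball a r, (w ∈ Ω ↔ t w < 0) := by
    intro w hw
    have : w ∈ Ω ∩ ball a r ↔ w ∈ {z ∈ ball a r | (e * z).im < φ ((e * z).re)} := by rw [hs]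
    simp only [mem_inter_iff, hw, and_true, mem_ofPred_eq, true_and] at this
    rw [this, ht]; simp
  have hfr : ∀ w ∈ frontier Ω ∩ ball a r, t w = 0 := by
    rintro w ⟨hw, hwb⟩
    have hwΩ : w ∉ Ω := by
      intro h; rw [hΩo.frontier_eq] at hw; exact hw.2 h
    have h0 : 0 ≤ t w := by
      by_contra! h; exact hwΩ ((hΩt w hwb).2 h)
    by_contra hne
    have hpos : 0 < t w := lt_of_le_of_ne h0 (Ne.symm hne)
    have hcl : w ∈ closure Ω := frontier_subset_closure hw
    rw [_root_.mem_closure_iff] at hcl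
    obtain ⟨x, ⟨hx1, hx2⟩, hx3⟩ := hcl ({x | 0 < t x} ∩ ball a r)
      ((isOpen_lt continuous_const htc.continuous).inter isOpen_ball) ⟨hpos, hwb⟩
    have := (hΩt x hx2).1 hx3
    simp only [mem_ofPred_eq] at hx1
    linarith
  refine ⟨hfr, ?_⟩
  obtain ⟨K, hK⟩ := htc.contDiffOn.exists_lipschitzOnWith (s := closedBall a r) one_ne_zero
    (convex_closedBall a r) (isCompact_closedBall a r)
  have hK' : ∀ p ∈ closedBall a r, ∀ q ∈ closedBall a r, t p - t q ≤ K * ‖p - q‖ := by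
    intro p hp q hq
    have := hK.dist_le_mul p hp q hq
    rw [Real.dist_eq, dist_eq_norm] at this
    exact (le_abs_self _).trans this
  have hta : t a = 0 := hfr a ⟨ha, mem_ball_self hr⟩
  refine ⟨K * max 1 r, by positivity, ?_⟩
  intro w hw hwΩ
  have hwr : ‖w - a‖ < r / 2 := by simpa [dist_eq_norm] using hw
  have hwb : w ∈ ball a r := ball_subset_ball (by linarith) hw
  have hwc : w ∈ closedBall a r := ball_subset_closedBall hwb
  have hac : a ∈ closedBall a r := mem_closedBall_self hr.le
  have hwa := hK' w hwc a hac
  rw [hta, sub_zero] at hwa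
  have h0 : 0 ≤ t w := by by_contra! h; exact hwΩ ((hΩt w hwb).2 h)
  have hKK : (K:ℝ) ≤ K * max 1 r := le_mul_of_one_le_right K.2 (le_max_left _ _)
  refine ⟨h0, ?_, ?_⟩
  · refine hwa.trans ?_
    have : ‖w - a‖ ≤ max 1 r := le_trans (by linarith) (le_max_right 1 r)
    gcongr
  · intro q hq
    suffices t w ≤ K * ‖w - q‖ from this.trans (by gcongr)
    by_cases hqb : q ∈ ball a r
    · have h1 := hK' w hwc q (ball_subset_closedBall hqb)
      have := (hΩt q hqb).1 hq
      linarith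
    · refine hwa.trans ?_
      have h1 : r ≤ ‖q - a‖ := by simpa [dist_eq_norm] using hqb
      have h2 : ‖q - a‖ ≤ ‖w - q‖ + ‖w - a‖ := by
        rw [norm_sub_rev w q]; exact norm_sub_le_norm_sub_add_norm_sub _ _ _
      gcongr
      linarith

lemma graph_null {e : ℂ} (he : ‖e‖ = 1) {φ : ℝ → ℝ} (hφ : ContDiff ℝ 1 φ) :
    volume {w : ℂ | (e * w).im - φ (e * w).re = 0} = 0 := by
  have hl : volume ((LinearMap.ker imLm : Submodule ℝ ℂ) : Set ℂ) = 0 := by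
    apply Measure.addHaar_submodule
    intro h
    have : I ∈ LinearMap.ker imLm := by rw [h]; trivial
    simp at this
  have hd : DifferentiableOn ℝ (fun v : ℂ => (starRingEnd ℂ) e * (v.re + I * φ v.re))
      (LinearMap.ker imLm : Submodule ℝ ℂ) := by
    have h1 : Differentiable ℝ (fun v : ℂ => (v.re : ℂ)) :=
      (ofRealCLM.comp reCLM).differentiable
    have h2 : Differentiable ℝ (fun v : ℂ => (φ v.re : ℂ)) :=
      ofRealCLM.differentiable.comp ((hφ.differentiable one_ne_zero).comp reCLM.differentiable)
    exact ((differentiable_const _).mul (h1.add ((differentiable_const _).mul h2))).differentiableOn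
  refine measure_mono_null ?_
    (addHaar_image_eq_zero_of_differentiableOn_of_addHaar_eq_zero volume hd hl)
  intro w hw
  have hw' : (e * w).im = φ (e * w).re := by simpa [sub_eq_zero] using hw
  refine ⟨((e * w).re : ℂ), by simp, ?_⟩
  have h1 : ((e * w).re : ℂ) + I * (φ (e * w).re : ℂ) = e * w := by
    rw [← hw', mul_comm I]; exact re_add_im _
  have h2 : (starRingEnd ℂ) e * e = 1 := by
    rw [← normSq_eq_conj_mul_self, normSq_eq_norm_sq, he]; simp
  show (starRingEnd ℂ) e * ((((e * w).re : ℂ)).re + I * φ (((e * w).re : ℂ)).re) = w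
  rw [ofReal_re, h1, ← mul_assoc, h2, one_mul]

lemma frontier_null {ε : ℝ} {Ω : Set ℂ} (hΩo : IsOpen Ω) (hΩ : HasC1HolderBoundaryC ε Ω) :
    volume (frontier Ω) = 0 := by
  apply measure_null_of_locally_null
  intro a ha
  obtain ⟨r, hr, e, he, φ, hφ, -, hs⟩ := hΩ a ha
  refine ⟨frontier Ω ∩ ball a r, inter_mem self_mem_nhdsWithin
    (mem_nhdsWithin_of_mem_nhds (ball_mem_nhds a hr)), ?_⟩
  exact measure_mono_null (local_t hΩo ha hr hφ hs).1 (graph_null he hφ)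

lemma local_D {ε : ℝ} (hε0 : 0 < ε) (hε1 : ε < 1) {Ω : Set ℂ} (hΩo : IsOpen Ω)
    (hΩ : HasC1HolderBoundaryC ε Ω) {a : ℂ} (ha : a ∈ frontier Ω) :
    ∃ r > 0, ∃ D : ℂ → ℂ, ContDiff ℝ 1 D ∧ (∀ w ∈ frontier Ω ∩ ball a r, D w = 0) ∧
      ∃ C : ℝ, 0 ≤ C ∧ ∀ w ∈ ball a r, w ∉ Ω → ∀ q ∈ Ω,
        ‖D w‖ ≤ C * ‖w - q‖ ^ ε ∧ ‖1 + db (fderiv ℝ D w)‖ ≤ C * ‖w - q‖ ^ ε := by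
  obtain ⟨r, hr, e, he, φ, hφ, ⟨c, hc⟩, hs⟩ := hΩ a ha
  obtain ⟨hfr, L, hL0, hL⟩ := local_t hΩo ha hr hφ hs
  have hee : e * (starRingEnd ℂ) e = 1 := by
    rw [mul_conj, normSq_eq_norm_sq, he]; simp
  have hφ' : Continuous (deriv φ) := hφ.continuous_deriv le_rfl
  set ψ : ℝ → ℝ := deriv φ with hψ
  set ν : ℝ → ℂ := fun s => (1 + I * ψ s)⁻¹ with hν
  have hden : ∀ s, (1 + I * (ψ s : ℂ)) ≠ 0 := by
    intro s h
    have := congrArg re h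
    simp at this
  have hden1 : ∀ s, 1 ≤ ‖(1 + I * (ψ s : ℂ))‖ := by
    intro s
    have := abs_re_le_norm (1 + I * (ψ s : ℂ))
    simpa using this
  have hνc : Continuous ν := by
    refine Continuous.inv₀ ?_ hden
    fun_prop
  have hν1 : ∀ s, ‖ν s‖ ≤ 1 := by
    intro s; rw [hν]; simp only [norm_inv]; exact inv_le_one_of_one_le₀ (hden1 s)
  have hνH : ∀ s s', ‖ν s - ν s'‖ ≤ c * |s - s'| ^ ε := by
    intro s s'
    have h1 := hc.dist_le (mem_univ s) (mem_univ s')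
    rw [Real.dist_eq, Real.dist_eq, Real.coe_toNNReal _ hε0.le] at h1
    refine le_trans ?_ h1
    have : ν s - ν s' = I * (ψ s' - ψ s) * ν s * ν s' := by
      simp only [hν]
      have := hden s
      have := hden s'
      field_simp
      ring
    rw [this, norm_mul, norm_mul, norm_mul, norm_I, one_mul, ← ofReal_sub, norm_real,
      Real.norm_eq_abs, abs_sub_comm]
    have h3 := hν1 s
    have h4 := hν1 s'
    calc |ψ s - ψ s'| * ‖ν s‖ * ‖ν s'‖ ≤ |ψ s - ψ s'| * 1 * 1 := by gcongr
      _ = _ := by ring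
  set N : ℝ → ℂ := fun s => ∫ x in (0:ℝ)..s, ν x with hN
  have hNd : ∀ s, HasDerivAt N (ν s) s := fun s => hνc.integral_hasStrictDerivAt 0 s |>.hasDerivAt
  have hNc : ContDiff ℝ 1 N := by
    rw [contDiff_one_iff_deriv]
    refine ⟨fun s => (hNd s).differentiableAt, ?_⟩
    have : deriv N = ν := funext fun s => (hNd s).deriv
    rw [this]; exact hνc
  have hNL : ∀ s s', ‖N s - N s'‖ ≤ |s - s'| := by
    intro s s'
    have := Convex.norm_image_sub_le_of_norm_hasDerivWithin_le (f := N) (f' := ν) (C := 1)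
      (fun x _ => (hNd x).hasDerivWithinAt) (fun x _ => hν1 x) convex_univ (mem_univ s') (mem_univ s)
    simpa using this
  set t : ℂ → ℝ := fun w => (e * w).im - φ (e * w).re with ht
  set D : ℂ → ℂ := fun w => 2 * I * e * (N ((e * w).re + t w) - N (e * w).re) with hD
  have h1 : ContDiff ℝ 1 (fun w : ℂ => e * w) := contDiff_const.mul contDiff_id
  have hx : ContDiff ℝ 1 (fun w : ℂ => (e * w).re) := reCLM.contDiff.comp h1
  have htc : ContDiff ℝ 1 t := (imCLM.contDiff.comp h1).sub (hφ.comp hx)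
  have hDc : ContDiff ℝ 1 D :=
    contDiff_const.mul ((hNc.comp (hx.add htc)).sub (hNc.comp hx))
  have hdb : ∀ w, 1 + db (fderiv ℝ D w) =
      I * (ν ((e * w).re + t w) - ν (e * w).re) * (1 - ψ (e * w).re + I) := by
    intro w
    set E : ℂ →L[ℝ] ℂ := ContinuousLinearMap.mul ℝ ℂ e with hE
    have hEd : HasFDerivAt (fun w : ℂ => e * w) E w := E.hasFDerivAt
    have hX : HasFDerivAt (fun w : ℂ => (e * w).re) (reCLM ∘L E) w := reCLM.hasFDerivAt.comp w hEd
    have hY : HasFDerivAt (fun w : ℂ => (e * w).im) (imCLM ∘L E) w := imCLM.hasFDerivAt.comp w hEd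
    have hφd : HasDerivAt φ (ψ (e * w).re) (e * w).re :=
      (hφ.differentiable one_ne_zero _).hasDerivAt
    have hT : HasFDerivAt t (imCLM ∘L E - (ψ (e * w).re) • (reCLM ∘L E)) w :=
      hY.sub (hφd.comp_hasFDerivAt w hX)
    have hXT := hX.add hT
    have hN1 := (hNd ((e * w).re + t w)).hasFDerivAt.comp w hXT
    have hN2 := (hNd (e * w).re).hasFDerivAt.comp w hX
    have hDd : HasFDerivAt D _ w := (hN1.sub hN2).const_mul (2 * I * e)
    rw [hDd.fderiv, db_smul, db_sub]
    have key : ν (e * w).re * (1 + I * ψ (e * w).re) = 1 := inv_mul_cancel₀ (hden _)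
    have hce : (starRingEnd ℂ) e = e.re - I * e.im := by
      apply Complex.ext <;> simp
    have hce' : I * (starRingEnd ℂ) e = e.im + I * e.re := by
      apply Complex.ext <;> simp
    generalize ν ((e * w).re + t w) = p at *
    generalize ν (e * w).re = p' at *
    generalize ψ (e * w).re = m at *
    simp only [db, ContinuousLinearMap.comp_apply, _root_.add_apply,
      _root_.sub_apply, _root_.smul_apply, hE,
      ContinuousLinearMap.mul_apply', reCLM_apply, imCLM_apply,
      ContinuousLinearMap.toSpanSingleton_apply, mul_one, mul_re, mul_im, I_re, I_im, mul_zero,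
      zero_sub, add_zero, smul_eq_mul, real_smul, ofReal_add, ofReal_sub, ofReal_mul,
      ofReal_neg]
    have hei : (e.im : ℂ) = I * (starRingEnd ℂ) e - I * e.re := by rw [hce']; ring
    rw [hce] at hee
    linear_combination (-1 : ℂ) * key + I * (p * (1 - m + I) - p') * hee
      + (I * e * e.im * p + p') * I_sq
  obtain ⟨Q, hQ⟩ : ∃ Q : ℝ, ∀ w ∈ closedBall a (r / 2), ‖(1 - ψ (e * w).re + I : ℂ)‖ ≤ Q := by
    apply (isCompact_closedBall a (r / 2)).exists_bound_of_continuousOn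
    have := hφ'.comp hx.continuous
    have h3 : Continuous (fun w : ℂ => (ψ (e * w).re : ℂ)) := continuous_ofReal.comp this
    fun_prop
  have hQ0 : 0 ≤ Q := (norm_nonneg _).trans (hQ a (mem_closedBall_self (by positivity)))
  refine ⟨r / 2, by positivity, D, hDc, ?_, 2 * L ^ (1 - ε) * L ^ ε + c * L ^ ε * Q,
    by positivity, ?_⟩
  · intro w hw
    have : t w = 0 := hfr w ⟨hw.1, ball_subset_ball (by linarith) hw.2⟩
    simp [hD, this]
  · intro w hw hwΩ q hq
    obtain ⟨t0, tL, tq⟩ := hL w hw hwΩ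
    replace tq := tq q hq
    change 0 ≤ t w at t0
    change t w ≤ L at tL
    change t w ≤ L * ‖w - q‖ at tq
    have hte : t w ^ ε ≤ L ^ ε * ‖w - q‖ ^ ε := by
      rw [← Real.mul_rpow hL0 (norm_nonneg _)]
      exact Real.rpow_le_rpow t0 tq hε0.le
    have hp1 : 0 ≤ c * L ^ ε * Q * ‖w - q‖ ^ ε := by positivity
    have hp2 : 0 ≤ 2 * L ^ (1 - ε) * L ^ ε * ‖w - q‖ ^ ε := by positivity
    constructor
    · have e1 : ‖D w‖ ≤ 2 * t w := by
        have := hNL ((e * w).re + t w) (e * w).re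
        rw [add_sub_cancel_left, abs_of_nonneg t0] at this
        simpa [hD, he] using this
      have e2 : t w = t w ^ (1 - ε) * t w ^ ε := by
        rw [← Real.rpow_add' t0 (by norm_num)]; simp
      have e3 : t w ^ (1 - ε) ≤ L ^ (1 - ε) := Real.rpow_le_rpow t0 tL (by linarith)
      calc ‖D w‖ ≤ 2 * (t w ^ (1 - ε) * t w ^ ε) := by rw [← e2]; exact e1
        _ ≤ 2 * (L ^ (1 - ε) * (L ^ ε * ‖w - q‖ ^ ε)) := by gcongr
        _ ≤ _ := by linarith
    · rw [hdb w, norm_mul, norm_mul, norm_I, one_mul]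
      have e1 := hνH ((e * w).re + t w) (e * w).re
      rw [add_sub_cancel_left, abs_of_nonneg t0] at e1
      have e2 := hQ w (ball_subset_closedBall hw)
      calc _ ≤ (c * t w ^ ε) * Q := by gcongr
        _ ≤ (c * (L ^ ε * ‖w - q‖ ^ ε)) * Q := by gcongr
        _ ≤ _ := by linarith

lemma exists_cutoffs {F : Set ℂ} (hF : IsCompact F) {ι : Type} [Fintype ι] (U : ι → Set ℂ)
    (hU : ∀ i, IsOpen (U i)) (hb : ∀ i, Bornology.IsBounded (U i)) (hFU : F ⊆ ⋃ i, U i) :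
    ∃ δ : ℝ, 0 < δ ∧ ∃ X : ι → ℂ → ℂ, (∀ i, ContDiff ℝ 1 (X i)) ∧
      (∀ i, HasCompactSupport (X i)) ∧ (∀ i, tsupport (X i) ⊆ U i) ∧ (∀ i w, ‖X i w‖ ≤ 1) ∧
      (∀ w, ‖1 - ∑ i, X i w‖ ≤ 1) ∧ (∀ w ∈ cthickening δ F, ∑ i, X i w = 1) := by
  obtain ⟨δ, hδ, hsub⟩ := hF.exists_cthickening_subset_open (isOpen_iUnion hU) hFU
  obtain ⟨f, hf⟩ := SmoothPartitionOfUnity.exists_isSubordinate (modelWithCornersSelf ℝ ℂ)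
    (isClosed_cthickening (δ := δ) (E := F)) U hU hsub
  have hsupp : ∀ i, tsupport (fun w => ((f i w : ℝ) : ℂ)) ⊆ U i := by
    intro i
    refine subset_trans (closure_mono ?_) (hf i)
    intro w hw h
    exact hw (by simp [h])
  have hsum : ∀ w, ∑ᶠ i, f i w = ∑ i, f i w := fun w => finsum_eq_sum_of_fintype _
  have h01 : ∀ w, 0 ≤ ∑ i, f i w := fun w => Finset.sum_nonneg fun i _ => f.nonneg i w
  refine ⟨δ, hδ, fun i w => ((f i w : ℝ) : ℂ), ?_, ?_, hsupp, ?_, ?_, ?_⟩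
  · intro i
    have : ContDiff ℝ 1 (f i) := ((f i).contMDiff.contDiff).of_le (by exact_mod_cast le_top)
    exact ofRealCLM.contDiff.comp this
  · intro i
    exact isCompact_of_isClosed_isBounded (isClosed_tsupport _) ((hb i).subset (hsupp i))
  · intro i w
    rw [norm_real, Real.norm_of_nonneg (f.nonneg i w)]
    exact f.le_one i w
  · intro w
    rw [← ofReal_sum, ← ofReal_one, ← ofReal_sub, norm_real, Real.norm_eq_abs, abs_le]
    have := f.sum_le_one w
    rw [hsum] at this
    constructor <;> linarith [h01 w]
  · intro w hw
    have := f.sum_eq_one hw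
    rw [hsum] at this
    rw [← ofReal_sum, this, ofReal_one]

lemma propA {ε : ℝ} (hε0 : 0 < ε) (hε1 : ε < 1) {Ω : Set ℂ} (hΩo : IsOpen Ω)
    (hΩb : Bornology.IsBounded Ω) (hΩ : HasC1HolderBoundaryC ε Ω) :
    ∃ (L : ℝ≥0) (C B : ℝ) (R : ℂ → ℂ), LipschitzWith L R ∧
    (∀ w ∈ Ω, R w = (starRingEnd ℂ) w) ∧ (∀ w, B < ‖w‖ → R w = (starRingEnd ℂ) w) ∧ 0 ≤ C ∧
    (∀ w ∉ closure Ω, DifferentiableAt ℝ R w ∧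
      ∀ q ∈ Ω, ‖db (fderiv ℝ R w)‖ ≤ C * ‖w - q‖ ^ ε) := by
  have hF : IsCompact (frontier Ω) :=
    isCompact_of_isClosed_isBounded isClosed_frontier (hΩb.closure.subset frontier_subset_closure)
  have hloc := fun a : frontier Ω => local_D hε0 hε1 hΩo hΩ a.2
  choose r hr D hDc hD0 c hc0 hc using hloc
  obtain ⟨T, hT⟩ := hF.elim_finite_subcover (fun a : frontier Ω => ball (a : ℂ) (r a))
    (fun a => isOpen_ball) (fun a ha => mem_iUnion.2 ⟨⟨a, ha⟩, mem_ball_self (hr _)⟩)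
  have hT' : frontier Ω ⊆ ⋃ i : T, ball ((i : frontier Ω) : ℂ) (r i) := by
    intro w hw
    obtain ⟨i, hi, h⟩ := mem_iUnion₂.1 (hT hw)
    exact mem_iUnion.2 ⟨⟨i, hi⟩, h⟩
  obtain ⟨δ, hδ, X, hXc, hXs, hXU, hX1, hXs1, hXone⟩ := exists_cutoffs hF
    (fun i : T => ball ((i : frontier Ω) : ℂ) (r i)) (fun i => isOpen_ball)
    (fun i => isBounded_ball) hT'
  have hXL : ∀ i, ∃ G : ℝ≥0, LipschitzWith G (X i) := fun i =>
    (hXc i).lipschitzWith_of_hasCompactSupport (hXs i) one_ne_zero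
  choose G hG using hXL
  set P : ℂ → ℂ := fun w => ∑ i : T, X i w * D i w with hP
  have hPc : ContDiff ℝ 1 P := ContDiff.sum fun i _ => (hXc i).mul (hDc i)
  have hPs : HasCompactSupport P := by
    refine HasCompactSupport.intro (K := ⋃ i : T, tsupport (X i))
      (isCompact_iUnion fun i => hXs i) ?_
    intro w hw
    simp only [mem_iUnion, not_exists] at hw
    exact Finset.sum_eq_zero fun i _ => by rw [image_eq_zero_of_notMem_tsupport (hw i), zero_mul]
  have hPf : ∀ w ∈ frontier Ω, P w = 0 := by
    intro w hw
    refine Finset.sum_eq_zero fun i _ => ?_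
    by_cases h : w ∈ tsupport (X i)
    · rw [hD0 i w ⟨hw, hXU i h⟩, mul_zero]
    · rw [image_eq_zero_of_notMem_tsupport h, zero_mul]
  obtain ⟨K, hK⟩ := hPc.lipschitzWith_of_hasCompactSupport hPs one_ne_zero
  set E : ℂ → ℂ := indicator Ωᶜ P with hE
  have hEL : LipschitzWith K E := by
    refine lip_glue hΩo.isClosed_compl ?_ ?_ ?_
    · intro x hx y hy
      rw [hE, indicator_of_mem hx, indicator_of_mem hy]
      exact hK x y
    · intro w hw
      rw [frontier_compl] at hw
      by_cases h : w ∈ Ωᶜ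
      · rw [hE, indicator_of_mem h, hPf w hw]
      · rw [hE, indicator_of_notMem h]
    · intro w hw; rw [hE, indicator_of_notMem hw]
  obtain ⟨B, hB⟩ := hPs.isCompact.isBounded.subset_closedBall 0
  have hCl : LipschitzWith 1 (fun w : ℂ => (starRingEnd ℂ) w) :=
    LipschitzWith.of_dist_le_mul fun p q => by
      rw [dist_eq_norm, ← map_sub, norm_conj, dist_eq_norm]; simp
  refine ⟨1 + K, (δ ^ ε)⁻¹ + ∑ i : T, (c i + c i * G i), B, fun w => (starRingEnd ℂ) w + E w,
    hCl.add hEL, ?_, ?_, ?_, ?_⟩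
  · intro w hw
    simp [hE, hw]
  · intro w hw
    have : P w = 0 := by
      apply image_eq_zero_of_notMem_tsupport
      intro h
      have := hB h
      simp at this
      linarith
    have hEw : E w = 0 := by
      by_cases h : w ∈ Ωᶜ
      · rw [hE, indicator_of_mem h, this]
      · rw [hE, indicator_of_notMem h]
    simp only [hEw, add_zero]
  · have : ∀ i : T, 0 ≤ c i := fun i => hc0 i
    have : 0 ≤ ∑ i : T, (c i + c i * G i) := Finset.sum_nonneg fun i _ => by
      have := this i; positivity
    positivity
  · intro w hw
    have hwΩ : w ∉ Ω := fun h => hw (subset_closure h)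
    have hXd : ∀ i : T, HasFDerivAt (fun w => X i w * D i w)
        (X i w • fderiv ℝ (D i) w + D i w • fderiv ℝ (X i) w) w := fun i =>
      ((hXc i).differentiable one_ne_zero w).hasFDerivAt.mul
        ((hDc i).differentiable one_ne_zero w).hasFDerivAt
    have hPd : HasFDerivAt P (∑ i : T, (X i w • fderiv ℝ (D i) w + D i w • fderiv ℝ (X i) w)) w :=
      HasFDerivAt.fun_sum fun i _ => hXd i
    have hEP : E =ᶠ[𝓝 w] P := by
      filter_upwards [isClosed_closure.isOpen_compl.mem_nhds hw] with x hx
      have hx' : x ∈ Ωᶜ := fun h => hx (subset_closure h)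
      exact indicator_of_mem hx' _
    have hEd := hPd.congr_of_eventuallyEq hEP
    have hRd := (conjCLE.hasFDerivAt (x := w)).add hEd
    have hRd' : HasFDerivAt (fun w => (starRingEnd ℂ) w + E w) _ w := hRd
    refine ⟨hRd'.differentiableAt, ?_⟩
    intro q hq
    rw [hRd'.fderiv, db_add, db_conj]
    have hdbsum : db (∑ i : T, (X i w • fderiv ℝ (D i) w + D i w • fderiv ℝ (X i) w)) =
        ∑ i : T, (X i w * db (fderiv ℝ (D i) w) + D i w * db (fderiv ℝ (X i) w)) := by
      have : ∀ S : Finset T, db (∑ i ∈ S, (X i w • fderiv ℝ (D i) w + D i w • fderiv ℝ (X i) w)) =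
        ∑ i ∈ S, (X i w * db (fderiv ℝ (D i) w) + D i w * db (fderiv ℝ (X i) w)) := by
        intro S
        induction S using Finset.induction_on with
        | empty => simp [db_zero]
        | insert i S hi ih =>
          rw [Finset.sum_insert hi, Finset.sum_insert hi, db_add, ih, db_add, db_smul, db_smul]
      exact this _
    rw [hdbsum]
    have hsplit : 1 + ∑ i : T, (X i w * db (fderiv ℝ (D i) w) + D i w * db (fderiv ℝ (X i) w)) =
        (1 - ∑ i : T, X i w) + ∑ i : T, (X i w * (1 + db (fderiv ℝ (D i) w)) +
          D i w * db (fderiv ℝ (X i) w)) := by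
      simp only [mul_add, mul_one, Finset.sum_add_distrib]; ring
    rw [hsplit, add_mul, Finset.sum_mul]
    refine (norm_add_le _ _).trans (add_le_add ?_ ((norm_sum_le _ _).trans
      (Finset.sum_le_sum fun i _ => ?_)))
    · by_cases hth : w ∈ cthickening δ (frontier Ω)
      · rw [hXone w hth]; simp; positivity
      · refine (hXs1 w).trans ?_
        obtain ⟨p, hp, -, hpw⟩ := exists_frontier hq hwΩ
        have h1 : δ ≤ ‖w - q‖ := by
          by_contra! h
          apply hth
          refine mem_cthickening_of_dist_le w p δ _ hp ?_
          rw [dist_eq_norm]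
          rw [norm_sub_rev q w] at hpw
          linarith
        have h2 : δ ^ ε ≤ ‖w - q‖ ^ ε := Real.rpow_le_rpow hδ.le h1 hε0.le
        have h3 : 0 < δ ^ ε := by positivity
        rw [inv_mul_eq_div, le_div_iff₀ h3]
        linarith
    · have hci := hc0 i
      by_cases hwi : w ∈ tsupport (X i)
      · obtain ⟨b1, b2⟩ := hc i w (hXU i hwi) hwΩ q hq
        have b3 : ‖db (fderiv ℝ (X i) w)‖ ≤ G i :=
          (norm_db _).trans (norm_fderiv_le_of_lipschitz ℝ (hG i))
        have b4 := hX1 i w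
        calc _ ≤ ‖X i w‖ * ‖1 + db (fderiv ℝ (D i) w)‖ + ‖D i w‖ * ‖db (fderiv ℝ (X i) w)‖ := by
              rw [← norm_mul, ← norm_mul]; exact norm_add_le _ _
          _ ≤ 1 * (c i * ‖w - q‖ ^ ε) + (c i * ‖w - q‖ ^ ε) * G i := by gcongr
          _ = _ := by ring
      · have h1 : X i w = 0 := image_eq_zero_of_notMem_tsupport hwi
        have h2 : fderiv ℝ (X i) w = 0 := fderiv_of_notMem_tsupport ℝ hwi
        rw [h1, h2, db_zero]
        simp
        positivity

/-- For a bounded `C^{1+ε}` domain `Ω ⊆ ℂ` and `n ≥ 1`, the kernel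
`K_n(z,ζ)` satisfies `|K_n(z,ζ)| ≤ C |z−ζ|^{−2+ε}` for `z ≠ ζ` in `Ω`, with `C = C(n,ε,Ω)`. -/
theorem statement9 (ε : ℝ) (hε0 : 0 < ε) (hε1 : ε < 1) (n : ℕ) (hn : 1 ≤ n)
    (Ω : Set ℂ) (hΩo : IsOpen Ω) (hΩc : IsConnected Ω)
    (hΩb : Bornology.IsBounded Ω) (hΩ : HasC1HolderBoundaryC ε Ω) :
    ∃ C : ℝ, 0 < C ∧
      ∀ z ∈ Ω, ∀ ζ ∈ Ω, z ≠ ζ →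
        ‖Kker Ω n z ζ‖ ≤ C * ‖z - ζ‖ ^ (-2 + ε) := by
  obtain ⟨L, C, B, R, hL, hR, hB, hC0, hC⟩ := propA hε0 hε1 hΩo hΩb hΩ
  exact propB hε0 hε1 hn hΩo (frontier_null hΩo hΩ) hL hR hB hC0 hC

end
end
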